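/- arXiv:1412.3881 — 6 statements merged into one kernel-verified Lean document; each statement's English description precedes it below -/
import Mathlib

section
/- For arbitrary integers p, q, r with 0 < p ≤ q ≤ r ≤ 2q, there exists a finite simple connected graph G such that ind-match(G) = p, min-match(G) = q, and match(G) = r. -/
namespace DIM

open SimpleGraph

variable {V : Type*}

/-- `M` is a matching of `G`: a set of edges of `G` that are pairwise disjoint. -/
def IsMatching (G : SimpleGraph V) (M : Set (Sym2 V)) : Prop :=
  M ⊆ G.edgeSet ∧ ∀ e ∈ M, ∀ e' ∈ M, e ≠ e' → ∀ v : V, v ∈ e → v ∉ e'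

/-- A maximal matching: a matching not properly contained in any other matching. -/
def IsMaximalMatching (G : SimpleGraph V) (M : Set (Sym2 V)) : Prop :=
  IsMatching G M ∧ ∀ M' : Set (Sym2 V), IsMatching G M' → M ⊆ M' → M' = M

/-- Two edges `e`, `e'` are 3-disjoint in `G`: they are disjoint and no edge `f` of `G`
meets both. -/
def ThreeDisjoint (G : SimpleGraph V) (e e' : Sym2 V) : Prop :=
  (∀ v : V, v ∈ e → v ∉ e') ∧
    ∀ f ∈ G.edgeSet, ¬((∃ v, v ∈ f ∧ v ∈ e) ∧ (∃ v, v ∈ f ∧ v ∈ e'))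

/-- An induced matching of `G`: a set of edges of `G` that are pairwise 3-disjoint. -/
def IsInducedMatching (G : SimpleGraph V) (M : Set (Sym2 V)) : Prop :=
  M ⊆ G.edgeSet ∧ ∀ e ∈ M, ∀ e' ∈ M, e ≠ e' → ThreeDisjoint G e e'

/-- `match(G)`: the maximum cardinality of a matching of `G`. -/
noncomputable def matchNum (G : SimpleGraph V) : ℕ :=
  sSup {n | ∃ M : Set (Sym2 V), IsMatching G M ∧ M.ncard = n}

/-- `min-match(G)`: the minimum cardinality of a maximal matching of `G`. -/
noncomputable def minMatchNum (G : SimpleGraph V) : ℕ :=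
  sInf {n | ∃ M : Set (Sym2 V), IsMaximalMatching G M ∧ M.ncard = n}

/-- `ind-match(G)`: the maximum cardinality of an induced matching of `G`. -/
noncomputable def indMatchNum (G : SimpleGraph V) : ℕ :=
  sSup {n | ∃ M : Set (Sym2 V), IsInducedMatching G M ∧ M.ncard = n}

/-- A dominating induced matching: an induced matching that is also a maximal matching. -/
def IsDIM (G : SimpleGraph V) (M : Set (Sym2 V)) : Prop :=
  IsInducedMatching G M ∧ IsMaximalMatching G M

/-- `S` is an independent set of `G`. -/
def IsIndepSet (G : SimpleGraph V) (S : Set V) : Prop :=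
  ∀ a ∈ S, ∀ b ∈ S, ¬G.Adj a b

/-- `C` is a vertex cover of `G`. -/
def IsVertexCover (G : SimpleGraph V) (C : Set V) : Prop :=
  ∀ ⦃u w : V⦄, G.Adj u w → u ∈ C ∨ w ∈ C

/-- `C` is a minimal vertex cover of `G`. -/
def IsMinimalVertexCover (G : SimpleGraph V) (C : Set V) : Prop :=
  IsVertexCover G C ∧ ∀ C' ⊆ C, IsVertexCover G C' → C' = C

/-- `G` is unmixed: all minimal vertex covers of `G` have the same cardinality. -/
def Unmixed (G : SimpleGraph V) : Prop :=
  ∀ C C' : Set V, IsMinimalVertexCover G C → IsMinimalVertexCover G C' →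
    C.ncard = C'.ncard

/-- The degree of a vertex, as the cardinality of its neighbourhood. -/
noncomputable def deg (G : SimpleGraph V) (v : V) : ℕ := (G.neighborSet v).ncard

/-- A decomposition `V = W ⊔ M` exhibiting a dominating induced matching of `G`:
`W` is an independent set, the complement of `W` is the (injective) family of vertices
`x j k` (`j : Fin m`, `k : Fin 2`), each pair `{x j 0, x j 1}` is an edge of `G`, and the
induced subgraph on the complement of `W` consists exactly of these `m` disjoint edges. -/
def IsDimDecomp (G : SimpleGraph V) (W : Set V) {m : ℕ} (x : Fin m → Fin 2 → V) : Prop :=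
  Function.Injective (fun p : Fin m × Fin 2 => x p.1 p.2) ∧
  (∀ v : V, v ∈ W ↔ ∀ j k, v ≠ x j k) ∧
  IsIndepSet G W ∧
  (∀ j, G.Adj (x j 0) (x j 1)) ∧
  (∀ j k j' k', G.Adj (x j k) (x j' k') → j = j')

/-- The (open) neighbourhood `N_G(U)` of a set of vertices. -/
def nbd (G : SimpleGraph V) (U : Set V) : Set V := {v | ∃ u ∈ U, G.Adj u v}

/-- The closed neighbourhood `N_G[U]` of a set of vertices. -/
def cnbd (G : SimpleGraph V) (U : Set V) : Set V := U ∪ nbd G U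

/-- `G` has a pendant triangle attached to `v`: a triangle through `v` whose other two
vertices have degree exactly `2` in `G`, while `deg v > 2`. -/
def HasPendantTriangle (G : SimpleGraph V) (v : V) : Prop :=
  ∃ t₁ t₂ : V, t₁ ≠ t₂ ∧ G.Adj v t₁ ∧ G.Adj v t₂ ∧ G.Adj t₁ t₂ ∧
    deg G t₁ = 2 ∧ deg G t₂ = 2 ∧ 2 < deg G v

/-- `A` is a maximal independent set of the induced subgraph of `G` on `S`. -/
def IsMaxIndepOn (G : SimpleGraph V) (S A : Set V) : Prop :=
  A ⊆ S ∧ IsIndepSet G A ∧ ∀ B, A ⊆ B → B ⊆ S → IsIndepSet G B → B = A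

/-- Vertex decomposability of the induced subgraph of `G` on the vertex set `S`:
either it is edgeless, or some vertex `v ∈ S` is a shedding vertex (no independent set
of `G_S \ N[v]` is a maximal independent set of `G_S \ v`) such that both
`G_S \ v` and `G_S \ N[v]` are vertex decomposable. -/
inductive VDOn (G : SimpleGraph V) : Set V → Prop
  | edgeless (S : Set V) : (∀ u ∈ S, ∀ w ∈ S, ¬G.Adj u w) → VDOn G S
  | shed (S : Set V) (v : V) : v ∈ S →
      (∀ A : Set V, A ⊆ S \ {u | u = v ∨ G.Adj v u} → IsIndepSet G A →
        ¬IsMaxIndepOn G (S \ {v}) A) →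
      VDOn G (S \ {v}) → VDOn G (S \ {u | u = v ∨ G.Adj v u}) → VDOn G S

/-- `G` is vertex decomposable. -/
def VertexDecomposable (G : SimpleGraph V) : Prop := VDOn G Set.univ

/-- `G` is chordal: every cycle of length greater than `3` has a chord, i.e. an edge of `G`
joining two vertices of the cycle which is not an edge of the cycle. -/
def IsChordal (G : SimpleGraph V) : Prop :=
  ∀ (v : V) (c : G.Walk v v), c.IsCycle → 3 < c.length →
    ∃ u w : V, u ∈ c.support ∧ w ∈ c.support ∧ G.Adj u w ∧ s(u, w) ∉ c.edges

/-- `C` is a vertex cover of the induced subgraph of `G` on `S`. -/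
def IsVertexCoverOn (G : SimpleGraph V) (S C : Set V) : Prop :=
  C ⊆ S ∧ ∀ ⦃u w : V⦄, G.Adj u w → u ∈ S → w ∈ S → u ∈ C ∨ w ∈ C

/-- `C` is a minimal vertex cover of the induced subgraph of `G` on `S`. -/
def IsMinimalVertexCoverOn (G : SimpleGraph V) (S C : Set V) : Prop :=
  IsVertexCoverOn G S C ∧ ∀ C' ⊆ C, IsVertexCoverOn G S C' → C' = C

/-- `W₀`: the non-isolated vertices of `G` lying in `W`. -/
def W0 (G : SimpleGraph V) (W : Set V) : Set V := W ∩ {v | ∃ u, G.Adj v u}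

/-- The set of indices `j` such that both endpoints of the matching edge
`{x j 0, x j 1}` have degree at least `2` in `G` (its cardinality is `m₂`). -/
def m2Set (G : SimpleGraph V) {m : ℕ} (x : Fin m → Fin 2 → V) : Set (Fin m) :=
  {j | 2 ≤ deg G (x j 0) ∧ 2 ≤ deg G (x j 1)}

/-- The set of indices `j` such that the matching edge `{x j 0, x j 1}` survives in
`G' = G \ N_G[M₂]` with both endpoints of degree at least `2` in `G'`
(its cardinality is `m₂'`; it is empty when `G'` is edgeless). -/
def m2Set' (G : SimpleGraph V) {m : ℕ} (x : Fin m → Fin 2 → V) (M₂ : Set V) :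
    Set (Fin m) :=
  {j | x j 0 ∉ cnbd G M₂ ∧ x j 1 ∉ cnbd G M₂ ∧
    2 ≤ (G.neighborSet (x j 0) \ cnbd G M₂).ncard ∧
    2 ≤ (G.neighborSet (x j 1) \ cnbd G M₂).ncard}

/-- `IN_G(U, W)`: the vertices of `W₀` that are isolated in `G \ N_G[U]`. -/
def INSet (G : SimpleGraph V) (W U : Set V) : Set V :=
  {w | w ∈ W0 G W ∧ w ∉ cnbd G U ∧ ∀ u : V, G.Adj w u → u ∈ cnbd G U}


section Isomorphism

variable {W : Type*}

theorem IsMatching.map_iso {G : SimpleGraph V} {H : SimpleGraph W} (e : G ≃g H)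
    {M : Set (Sym2 V)} (hM : IsMatching G M) : IsMatching H (Sym2.map e '' M) := by
  refine ⟨?_, ?_⟩
  · rintro _ ⟨f, hf, rfl⟩
    have hf' := hM.1 hf
    induction f with
    | _ x y => exact e.map_adj_iff.2 hf'
  · rintro _ ⟨f, hf, rfl⟩ _ ⟨g, hg, rfl⟩ hne v hv hv'
    obtain ⟨x, hx, rfl⟩ := Sym2.mem_map.1 hv
    obtain ⟨y, hy, hyx⟩ := Sym2.mem_map.1 hv'
    obtain rfl := e.injective hyx
    exact hM.2 f hf g hg (fun h => hne (h ▸ rfl)) y hx hy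

theorem IsInducedMatching.map_iso {G : SimpleGraph V} {H : SimpleGraph W} (e : G ≃g H)
    {M : Set (Sym2 V)} (hM : IsInducedMatching G M) :
    IsInducedMatching H (Sym2.map e '' M) := by
  refine ⟨?_, ?_⟩
  · rintro _ ⟨f, hf, rfl⟩
    have hf' := hM.1 hf
    induction f with
    | _ x y => exact e.map_adj_iff.2 hf'
  · rintro _ ⟨f, hf, rfl⟩ _ ⟨g, hg, rfl⟩ hne
    obtain ⟨h₁, h₂⟩ := hM.2 f hf g hg (fun h => hne (h ▸ rfl))
    refine ⟨fun v hv hv' => ?_, ?_⟩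
    · obtain ⟨x, hx, rfl⟩ := Sym2.mem_map.1 hv
      obtain ⟨y, hy, hyx⟩ := Sym2.mem_map.1 hv'
      obtain rfl := e.injective hyx
      exact h₁ y hx hy
    · rintro k hk ⟨⟨v, hvk, hv⟩, w, hwk, hw⟩
      obtain ⟨x, hx, rfl⟩ := Sym2.mem_map.1 hv
      obtain ⟨y, hy, rfl⟩ := Sym2.mem_map.1 hw
      refine h₂ (Sym2.map e.symm k) ?_
        ⟨⟨x, Sym2.mem_map.2 ⟨_, hvk, by simp⟩, hx⟩, y, Sym2.mem_map.2 ⟨_, hwk, by simp⟩, hy⟩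
      induction k with
      | _ a b => exact e.symm.map_adj_iff.2 hk

theorem image_map_iso_symm {G : SimpleGraph V} {H : SimpleGraph W} (e : G ≃g H)
    (M : Set (Sym2 W)) : Sym2.map e '' (Sym2.map e.symm '' M) = M := by
  have : (Sym2.map e ∘ Sym2.map e.symm) = id := by
    rw [← Sym2.map_comp]
    have h : (e ∘ e.symm : W → W) = id := by ext; simp
    rw [h, Sym2.map_id]
  rw [← Set.image_comp, this, Set.image_id]

theorem IsMaximalMatching.map_iso {G : SimpleGraph V} {H : SimpleGraph W} (e : G ≃g H)
    {M : Set (Sym2 V)} (hM : IsMaximalMatching G M) :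
    IsMaximalMatching H (Sym2.map e '' M) := by
  refine ⟨hM.1.map_iso e, fun M' hM' hsub => ?_⟩
  rw [← hM.2 _ (hM'.map_iso e.symm), image_map_iso_symm]
  have h := Set.image_mono (f := Sym2.map e.symm) hsub
  rwa [show M = Sym2.map e.symm '' (Sym2.map e '' M) from (image_map_iso_symm e.symm M).symm]

theorem exists_ncard_iff_of_iso {G : SimpleGraph V} {H : SimpleGraph W} (e : G ≃g H)
    {P : Set (Sym2 V) → Prop} {Q : Set (Sym2 W) → Prop}
    (hPQ : ∀ M, P M → Q (Sym2.map e '' M)) (hQP : ∀ M, Q M → P (Sym2.map e.symm '' M)) :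
    {n | ∃ M, P M ∧ M.ncard = n} = {n | ∃ M, Q M ∧ M.ncard = n} := by
  ext n
  constructor
  · rintro ⟨M, hM, rfl⟩
    exact ⟨_, hPQ M hM, Set.ncard_image_of_injective _ (Sym2.map.injective e.injective)⟩
  · rintro ⟨M, hM, rfl⟩
    exact ⟨_, hQP M hM, Set.ncard_image_of_injective _ (Sym2.map.injective e.symm.injective)⟩

theorem matchNum_eq_of_iso {G : SimpleGraph V} {H : SimpleGraph W} (e : G ≃g H) :
    matchNum G = matchNum H :=
  congrArg sSup <| exists_ncard_iff_of_iso e (fun _ h => h.map_iso e) fun _ h => h.map_iso e.symm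

theorem minMatchNum_eq_of_iso {G : SimpleGraph V} {H : SimpleGraph W} (e : G ≃g H) :
    minMatchNum G = minMatchNum H :=
  congrArg sInf <| exists_ncard_iff_of_iso e (fun _ h => h.map_iso e) fun _ h => h.map_iso e.symm

theorem indMatchNum_eq_of_iso {G : SimpleGraph V} {H : SimpleGraph W} (e : G ≃g H) :
    indMatchNum G = indMatchNum H :=
  congrArg sSup <| exists_ncard_iff_of_iso e (fun _ h => h.map_iso e) fun _ h => h.map_iso e.symm

end Isomorphism

section Counting

theorem card_le_two_mul_card_of_covered [DecidableEq V] (S : Finset V) (N : Finset (Sym2 V))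
    (h : ∀ v ∈ S, ∃ e ∈ N, v ∈ e) : S.card ≤ 2 * N.card := by
  have hsub : S ⊆ N.biUnion Sym2.toFinset := fun v hv => by
    obtain ⟨e, he, hve⟩ := h v hv
    exact Finset.mem_biUnion.2 ⟨e, he, Sym2.mem_toFinset.2 hve⟩
  refine (Finset.card_le_card hsub).trans ?_
  rw [mul_comm]
  refine Finset.card_biUnion_le_card_mul _ _ _ fun e _ => ?_
  rw [Sym2.card_toFinset]
  split_ifs <;> omega

theorem IsMatching.two_mul_ncard_le [Fintype V] {G : SimpleGraph V} {M : Set (Sym2 V)}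
    (hM : IsMatching G M) : 2 * M.ncard ≤ Fintype.card V := by
  classical
  rw [Set.ncard_eq_toFinset_card', mul_comm]
  have hcard : (M.toFinset.biUnion Sym2.toFinset).card = M.toFinset.card * 2 := by
    rw [Finset.card_biUnion, Finset.sum_const_nat]
    · intro e he
      exact Sym2.card_toFinset_of_not_isDiag e
        (G.not_isDiag_of_mem_edgeSet (hM.1 (Set.mem_toFinset.1 he)))
    · intro e he e' he' hne
      refine Finset.disjoint_left.2 fun v hv hv' => ?_
      exact hM.2 e (Set.mem_toFinset.1 he) e' (Set.mem_toFinset.1 he') hne v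
        (Sym2.mem_toFinset.1 hv) (Sym2.mem_toFinset.1 hv')
  exact hcard ▸ Finset.card_le_univ _

theorem IsMaximalMatching.covered_of_adj {G : SimpleGraph V} {M : Set (Sym2 V)}
    (hM : IsMaximalMatching G M) {x y : V} (hxy : G.Adj x y) :
    (∃ e ∈ M, x ∈ e) ∨ ∃ e ∈ M, y ∈ e := by
  by_contra! h
  have hM' : IsMatching G (insert s(x, y) M) := by
    refine ⟨Set.insert_subset hxy hM.1.1, ?_⟩
    rintro e (rfl | he) e' (rfl | he') hne v hv hv'
    · exact hne rfl
    · rcases Sym2.mem_iff.1 hv with rfl | rfl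
      · exact h.1 e' he' hv'
      · exact h.2 e' he' hv'
    · rcases Sym2.mem_iff.1 hv' with rfl | rfl
      · exact h.1 e he hv
      · exact h.2 e he hv
    · exact hM.1.2 e he e' he' hne v hv hv'
  have hmem : s(x, y) ∈ M := by
    rw [← hM.2 _ hM' (Set.subset_insert _ _)]
    exact Set.mem_insert _ _
  exact h.1 _ hmem (Sym2.mem_mk_left x y)

theorem isMatching_range {κ : Type*} {G : SimpleGraph V} {f : κ → Sym2 V}
    (hf : ∀ k, f k ∈ G.edgeSet) (hd : ∀ k k' v, v ∈ f k → v ∈ f k' → k = k') :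
    IsMatching G (Set.range f) := by
  refine ⟨Set.range_subset_iff.2 hf, ?_⟩
  rintro _ ⟨k, rfl⟩ _ ⟨k', rfl⟩ hne v hv hv'
  exact hne (congrArg f (hd k k' v hv hv'))

theorem ncard_range_of_disjoint {κ : Type*} [Fintype κ] {f : κ → Sym2 V}
    (hd : ∀ k k' v, v ∈ f k → v ∈ f k' → k = k') :
    (Set.range f).ncard = Fintype.card κ := by
  have hinj : Function.Injective f := fun k k' h => by
    obtain ⟨v, hv⟩ : ∃ v, v ∈ f k := ⟨_, Sym2.out_fst_mem _⟩
    exact hd k k' v hv (h ▸ hv)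
  rw [← Set.image_univ, Set.ncard_image_of_injective _ hinj, Set.ncard_univ,
    Nat.card_eq_fintype_card]

end Counting

section Construction

variable {γ β ι : Type*}

/-- Vertices of `cliqueHub`: a hub `none`, a pair of core vertices for every element of
`γ ⊕ β`, and a pair of leaves for every element of `β`. -/
abbrev HubVertex (γ β : Type*) : Type _ := Option (((γ ⊕ β) × Bool) ⊕ (β × Bool))

/-- The core vertex with index `a` and side `b`. -/
abbrev core (a : γ ⊕ β) (b : Bool) : HubVertex γ β := some (Sum.inl (a, b))

/-- The leaf attached to the core vertex with index `Sum.inr j` and side `b`. -/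
abbrev leaf (j : β) (b : Bool) : HubVertex γ β := some (Sum.inr (j, b))

/-- Adjacency of `cliqueHub`. -/
def HubAdj (c : γ ⊕ β → ι) : HubVertex γ β → HubVertex γ β → Prop
  | none, some (Sum.inl _) => True
  | some (Sum.inl _), none => True
  | some (Sum.inl x), some (Sum.inl y) => c x.1 = c y.1 ∧ x ≠ y
  | some (Sum.inl x), some (Sum.inr y) => x.1 = Sum.inr y.1 ∧ x.2 = y.2
  | some (Sum.inr y), some (Sum.inl x) => x.1 = Sum.inr y.1 ∧ x.2 = y.2
  | _, _ => False

/-- The core vertices form a disjoint union of cliques given by the fibres of `c`, the hub is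
joined to every core vertex, and the core vertices indexed by `β` carry a pendant leaf each. -/
def cliqueHub (c : γ ⊕ β → ι) : SimpleGraph (HubVertex γ β) where
  Adj := HubAdj c
  symm := ⟨by
    rintro (_ | _ | _) (_ | _ | _) h <;> simp_all [HubAdj, eq_comm]⟩
  loopless := ⟨by rintro (_ | _ | _) h <;> simp_all [HubAdj]⟩

variable (c : γ ⊕ β → ι)

theorem cliqueHub_adj_hub_core (a : γ ⊕ β) (b : Bool) : (cliqueHub c).Adj none (core a b) :=
  trivial

theorem cliqueHub_adj_core_leaf (j : β) (b : Bool) :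
    (cliqueHub c).Adj (core (Sum.inr j) b) (leaf j b) :=
  ⟨rfl, rfl⟩

theorem cliqueHub_adj_core_core {a a' : γ ⊕ β} {b b' : Bool} :
    (cliqueHub c).Adj (core a b) (core a' b') ↔ c a = c a' ∧ (a, b) ≠ (a', b') :=
  Iff.rfl

theorem cliqueHub_adj_true_false (a : γ ⊕ β) :
    (cliqueHub c).Adj (core a true) (core a false) :=
  ⟨rfl, by simp⟩

theorem cliqueHub_connected : (cliqueHub c).Connected := by
  have hcore (a : γ ⊕ β) (b : Bool) : (cliqueHub c).Reachable none (core a b) :=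
    (cliqueHub_adj_hub_core c a b).reachable
  refine (connected_iff_exists_forall_reachable _).2 ⟨none, ?_⟩
  rintro (_ | ⟨a, b⟩ | ⟨j, b⟩)
  · exact Reachable.refl _
  · exact hcore a b
  · exact (hcore _ b).trans (cliqueHub_adj_core_leaf c j b).reachable

theorem exists_core_mem {e : Sym2 (HubVertex γ β)} (he : e ∈ (cliqueHub c).edgeSet) :
    ∃ a b, core a b ∈ e := by
  induction e with
  | _ x y =>
    rcases x with _ | ⟨a, b⟩ | ⟨j, b⟩
    · rcases y with _ | ⟨a, b⟩ | ⟨j, b⟩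
      · exact he.elim
      · exact ⟨a, b, Sym2.mem_mk_right _ _⟩
      · exact he.elim
    · exact ⟨a, b, Sym2.mem_mk_left _ _⟩
    · rcases y with _ | ⟨a, b⟩ | ⟨j, b⟩
      · exact he.elim
      · exact ⟨a, b, Sym2.mem_mk_right _ _⟩
      · exact he.elim

theorem same_fibre_of_mem_edge {e : Sym2 (HubVertex γ β)} (he : e ∈ (cliqueHub c).edgeSet)
    {a a' : γ ⊕ β} {b b' : Bool} (h : core a b ∈ e) (h' : core a' b' ∈ e) : c a = c a' := by
  by_cases heq : (core a b : HubVertex γ β) = core a' b'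
  · simp only [Option.some.injEq, Sum.inl.injEq, Prod.mk.injEq] at heq
    rw [heq.1]
  · rw [(Sym2.mem_and_mem_iff heq).1 ⟨h, h'⟩] at he
    exact ((cliqueHub_adj_core_core c).1 he).1

theorem mem_pair_core {a : γ ⊕ β} {v : HubVertex γ β} :
    v ∈ s(core a true, core a false) ↔ ∃ b, v = core a b := by
  simp [or_comm]

theorem pair_core_disjoint (a a' : γ ⊕ β) (v : HubVertex γ β)
    (h : v ∈ s(core a true, core a false)) (h' : v ∈ s(core a' true, core a' false)) :
    a = a' := by
  obtain ⟨b, rfl⟩ := mem_pair_core.1 h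
  obtain ⟨b', hb'⟩ := mem_pair_core.1 h'
  simp only [Option.some.injEq, Sum.inl.injEq, Prod.mk.injEq] at hb'
  exact hb'.1

theorem indMatchNum_cliqueHub [Fintype ι] (hc : Function.Surjective c) :
    indMatchNum (cliqueHub c) = Fintype.card ι := by
  refine IsGreatest.csSup_eq ⟨?_, ?_⟩
  · obtain ⟨σ, hσ⟩ := hc.hasRightInverse
    have hd (i i' : ι) (v : HubVertex γ β) (h : v ∈ s(core (σ i) true, core (σ i) false))
        (h' : v ∈ s(core (σ i') true, core (σ i') false)) : i = i' :=
      hσ.injective (pair_core_disjoint _ _ v h h')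
    refine ⟨Set.range fun i => s(core (σ i) true, core (σ i) false), ⟨?_, ?_⟩,
      ncard_range_of_disjoint hd⟩
    · rintro _ ⟨i, rfl⟩
      exact cliqueHub_adj_true_false c _
    · rintro _ ⟨i, rfl⟩ _ ⟨i', rfl⟩ hne
      have hii' : i ≠ i' := fun h => hne (h ▸ rfl)
      refine ⟨fun v h h' => hii' (hd i i' v h h'), ?_⟩
      rintro f hf ⟨⟨v, hvf, hv⟩, w, hwf, hw⟩
      obtain ⟨b, rfl⟩ := mem_pair_core.1 hv
      obtain ⟨b', rfl⟩ := mem_pair_core.1 hw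
      have := same_fibre_of_mem_edge c hf hvf hwf
      rw [hσ, hσ] at this
      exact hii' this
  · rintro _ ⟨M, hM, rfl⟩
    choose a b hab using fun e : M => exists_core_mem c (hM.1 e.2)
    rw [← Nat.card_coe_set_eq, ← Nat.card_eq_fintype_card]
    refine Nat.card_le_card_of_injective (fun e => c (a e)) fun e e' h => ?_
    by_contra hne
    obtain ⟨h₁, h₂⟩ := hM.2 e e.2 e' e'.2 (fun h => hne (Subtype.ext h))
    by_cases heq : (core (a e) (b e) : HubVertex γ β) = core (a e') (b e')
    · exact h₁ _ (hab e) (heq ▸ hab e')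
    · refine h₂ s(core (a e) (b e), core (a e') (b e')) ?_
        ⟨⟨_, Sym2.mem_mk_left _ _, hab e⟩, _, Sym2.mem_mk_right _ _, hab e'⟩
      exact (cliqueHub_adj_core_core c).2 ⟨h, fun h => heq (by rw [core, h])⟩

theorem isMaximalMatching_range_pair_core :
    IsMaximalMatching (cliqueHub c)
      (Set.range fun a : γ ⊕ β => s(core a true, core a false)) := by
  refine ⟨isMatching_range (cliqueHub_adj_true_false c) pair_core_disjoint,
    fun M' hM' hsub => hsub.antisymm' fun e he => ?_⟩
  obtain ⟨a, b, hab⟩ := exists_core_mem c (hM'.1 he)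
  refine ⟨a, ?_⟩
  by_contra hne
  exact hM'.2 _ (hsub ⟨a, rfl⟩) e he hne (core a b) (mem_pair_core.2 ⟨b, rfl⟩) hab

theorem card_le_ncard_of_isMaximalMatching [Fintype γ] [Fintype β] [Fintype ι]
    {M : Set (Sym2 (HubVertex γ β))}
    (hM : IsMaximalMatching (cliqueHub c) M) : Fintype.card (γ ⊕ β) ≤ M.ncard := by
  classical
  let N (i : ι) : Finset (Sym2 (HubVertex γ β)) :=
    M.toFinset.filter fun e => ∃ a b, c a = i ∧ core a b ∈ e
  let F (i : ι) : Finset (γ ⊕ β) := Finset.univ.filter fun a => c a = i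
  let S (i : ι) : Finset (HubVertex γ β) :=
    (F i ×ˢ Finset.univ).map ⟨fun x => core x.1 x.2, fun x y h => by simpa using h⟩
  have hS (i : ι) : (S i).card = (F i).card * 2 := by simp [S]
  have hmemS (i : ι) (v : HubVertex γ β) : v ∈ S i ↔ ∃ a b, c a = i ∧ core a b = v := by
    simp only [S, F, Finset.mem_map, Finset.mem_product, Finset.mem_filter, Finset.mem_univ,
      true_and, and_true, Prod.exists]
    rfl
  have hFN (i : ι) : (F i).card ≤ (N i).card := by
    have hcov := card_le_two_mul_card_of_covered
      ((S i).filter fun v => ∃ e ∈ M, v ∈ e) (N i) (by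
        intro v hv
        obtain ⟨hv, e, he, hve⟩ := Finset.mem_filter.1 hv
        obtain ⟨a, b, ha, rfl⟩ := (hmemS i v).1 hv
        exact ⟨e, Finset.mem_filter.2 ⟨Set.mem_toFinset.2 he, a, b, ha, hve⟩, hve⟩)
    have hunc : ((S i).filter fun v => ¬∃ e ∈ M, v ∈ e).card ≤ 1 := by
      refine Finset.card_le_one.2 fun v hv w hw => ?_
      obtain ⟨hv, hv'⟩ := Finset.mem_filter.1 hv
      obtain ⟨hw, hw'⟩ := Finset.mem_filter.1 hw
      obtain ⟨a, b, ha, rfl⟩ := (hmemS i v).1 hv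
      obtain ⟨a', b', ha', rfl⟩ := (hmemS i w).1 hw
      by_contra hne
      exact (hM.covered_of_adj ((cliqueHub_adj_core_core c).2
        ⟨ha.trans ha'.symm, fun h => hne (by rw [core, h])⟩)).elim hv' hw'
    have hsum := Finset.card_filter_add_card_filter_not (s := S i) (fun v => ∃ e ∈ M, v ∈ e)
    have := hS i
    omega
  have hdisj : (Finset.univ.biUnion N).card = ∑ i, (N i).card := by
    refine Finset.card_biUnion fun i _ i' _ hne => Finset.disjoint_left.2 fun e he he' => hne ?_
    obtain ⟨heM, a, b, rfl, hab⟩ := Finset.mem_filter.1 he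
    obtain ⟨_, a', b', rfl, hab'⟩ := Finset.mem_filter.1 he'
    exact same_fibre_of_mem_edge c (hM.1.1 (Set.mem_toFinset.1 heM)) hab hab'
  calc Fintype.card (γ ⊕ β) = ∑ i, (F i).card :=
        Finset.card_eq_sum_card_fiberwise fun _ _ => Finset.mem_coe.2 (Finset.mem_univ _)
    _ ≤ ∑ i, (N i).card := Finset.sum_le_sum fun i _ => hFN i
    _ = (Finset.univ.biUnion N).card := hdisj.symm
    _ ≤ M.toFinset.card :=
        Finset.card_le_card <| Finset.biUnion_subset.2 fun _ _ => Finset.filter_subset _ _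
    _ = M.ncard := (Set.ncard_eq_toFinset_card' M).symm

theorem minMatchNum_cliqueHub [Fintype γ] [Fintype β] [Fintype ι] :
    minMatchNum (cliqueHub c) = Fintype.card (γ ⊕ β) := by
  refine IsLeast.csInf_eq ⟨⟨_, isMaximalMatching_range_pair_core c,
    ncard_range_of_disjoint pair_core_disjoint⟩, ?_⟩
  rintro _ ⟨M, hM, rfl⟩
  exact card_le_ncard_of_isMaximalMatching c hM

theorem matchNum_cliqueHub [Fintype γ] [Fintype β] :
    matchNum (cliqueHub c) = Fintype.card γ + 2 * Fintype.card β := by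
  refine IsGreatest.csSup_eq ⟨?_, ?_⟩
  · let f : γ ⊕ (β × Bool) → Sym2 (HubVertex γ β) :=
      Sum.elim (fun g => s(core (Sum.inl g) true, core (Sum.inl g) false))
        fun x => s(core (Sum.inr x.1) x.2, leaf x.1 x.2)
    have hd (k k' v) (h : v ∈ f k) (h' : v ∈ f k') : k = k' := by
      rcases k with g | ⟨j, b⟩ <;> rcases k' with g' | ⟨j', b'⟩ <;>
        simp only [f, Sum.elim_inl, Sum.elim_inr, Sym2.mem_iff] at h h' <;>
        rcases h with rfl | rfl <;> simp_all
    refine ⟨Set.range f, isMatching_range ?_ hd, ?_⟩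
    · rintro (g | ⟨j, b⟩)
      · exact cliqueHub_adj_true_false c _
      · exact cliqueHub_adj_core_leaf c j b
    · rw [ncard_range_of_disjoint hd]
      simp [mul_comm]
  · rintro _ ⟨M, hM, rfl⟩
    have := hM.two_mul_ncard_le
    simp only [Fintype.card_option, Fintype.card_sum, Fintype.card_prod, Fintype.card_bool]
      at this
    omega

end Construction

/-- for all integers `0 < p ≤ q ≤ r ≤ 2q` there is a finite simple connected
graph `G` with `ind-match(G) = p`, `min-match(G) = q` and `match(G) = r`. -/
theorem exists_connected_graph_with_matching_numbers
    (p q r : ℕ) (hp : 0 < p) (hpq : p ≤ q) (hqr : q ≤ r) (hr : r ≤ 2 * q) :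
    ∃ (n : ℕ) (G : SimpleGraph (Fin n)),
      G.Connected ∧ indMatchNum G = p ∧ minMatchNum G = q ∧ matchNum G = r := by
  have hqr' : q - (r - q) + (r - q) = q := by omega
  have : Nonempty (Fin p) := ⟨⟨0, hp⟩⟩
  obtain ⟨g⟩ : Nonempty (Fin p ↪ Fin (q - (r - q)) ⊕ Fin (r - q)) :=
    Function.Embedding.nonempty_of_card_le (by simpa [hqr'] using hpq)
  let c := Function.invFun g
  have hc : Function.Surjective c := Function.invFun_surjective g.injective
  let e := Fintype.equivFin (HubVertex (Fin (q - (r - q))) (Fin (r - q)))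
  let φ := SimpleGraph.Iso.map e (cliqueHub c)
  refine ⟨_, (cliqueHub c).map e,
    (SimpleGraph.Iso.connected_iff φ).1 (cliqueHub_connected c), ?_, ?_, ?_⟩
  · rw [← indMatchNum_eq_of_iso φ, indMatchNum_cliqueHub c hc, Fintype.card_fin]
  · rw [← minMatchNum_eq_of_iso φ, minMatchNum_cliqueHub c, Fintype.card_sum, Fintype.card_fin,
      Fintype.card_fin, hqr']
  · rw [← matchNum_eq_of_iso φ, matchNum_cliqueHub c, Fintype.card_fin, Fintype.card_fin]
    omega

end DIM
end

section
/- Let a, b be non-negative integers and let G_{a,b} be the graph consisting of the complete bipartite graph (star) K_{1,a+b+1} with bipartition {x} ⊔ {y_1, …, y_{a+b+1}}, together with, for each i = 1, …, a+1, a 5-cycle through y_i (obtained by adding 4 new vertices forming a cycle of length 5 with y_i), and, for each i = a+2, …, a+b+1, a 4-cycle through y_i (obtained by adding 3 new vertices forming a cycle of length 4 with y_i), where all the added vertices are distinct. Then ind-match(G_{a,b}) = a + b + 2, min-match(G_{a,b}) = 2a + 2b + 2, and match(G_{a,b}) = 2a + 2b + 3. -/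
namespace DIM

open SimpleGraph

variable {V : Type*}

/-- Vertex set of the graph `G_{a,b}`: the centre `x` of the star, the vertices
`y_1, …, y_{a+b+1}`, four extra vertices for each of the `a+1` attached 5-cycles,
and three extra vertices for each of the `b` attached 4-cycles. -/
abbrev Vab (a b : ℕ) := Unit ⊕ Fin (a + b + 1) ⊕ (Fin (a + 1) × Fin 4) ⊕ (Fin b × Fin 3)

def vabx {a b : ℕ} : Vab a b := Sum.inl ()
def vaby {a b : ℕ} (i : Fin (a + b + 1)) : Vab a b := Sum.inr (Sum.inl i)
def vab5 {a b : ℕ} (i : Fin (a + 1)) (k : Fin 4) : Vab a b :=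
  Sum.inr (Sum.inr (Sum.inl (i, k)))
def vab4 {a b : ℕ} (i : Fin b) (k : Fin 3) : Vab a b :=
  Sum.inr (Sum.inr (Sum.inr (i, k)))

/-- The vertex `y_i` (`i = 1, …, a+1`) to which the `i`-th 5-cycle is attached. -/
def y5 {a b : ℕ} (i : Fin (a + 1)) : Fin (a + b + 1) := ⟨i.1, by have := i.2; omega⟩
/-- The vertex `y_{a+1+i}` (`i = 1, …, b`) to which the `i`-th 4-cycle is attached. -/
def y4 {a b : ℕ} (i : Fin b) : Fin (a + b + 1) := ⟨a + 1 + i.1, by have := i.2; omega⟩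

/-- The graph `G_{a,b}`: the star `K_{1,a+b+1}` with a 5-cycle attached to each of
`y_1, …, y_{a+1}` and a 4-cycle attached to each of `y_{a+2}, …, y_{a+b+1}`. -/
def Gab (a b : ℕ) : SimpleGraph (Vab a b) :=
  SimpleGraph.fromEdgeSet (
    {e | ∃ i : Fin (a + b + 1), e = s(vabx, vaby i)} ∪
    {e | ∃ i : Fin (a + 1),
        e = s(vaby (y5 i), vab5 i 0) ∨ e = s(vab5 i 0, vab5 i 1) ∨
        e = s(vab5 i 1, vab5 i 2) ∨ e = s(vab5 i 2, vab5 i 3) ∨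
        e = s(vab5 i 3, vaby (y5 i))} ∪
    {e | ∃ i : Fin b,
        e = s(vaby (y4 i), vab4 i 0) ∨ e = s(vab4 i 0, vab4 i 1) ∨
        e = s(vab4 i 1, vab4 i 2) ∨ e = s(vab4 i 2, vaby (y4 i))})

section EdgeParametrization

variable {E : Type*} {G : SimpleGraph V} {ends : E → Sym2 V}

/-- The edges labelled `e` and `e'` have a common endpoint. -/
def Share (ends : E → Sym2 V) (e e' : E) : Prop := ∃ v, v ∈ ends e ∧ v ∈ ends e'

lemma share_self (e : E) : Share ends e e :=
  ⟨_, Sym2.out_fst_mem _, Sym2.out_fst_mem _⟩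

lemma isMatching_image_iff (hinj : ends.Injective) (hran : Set.range ends = G.edgeSet)
    (T : Set E) :
    IsMatching G (ends '' T) ↔ ∀ e ∈ T, ∀ e' ∈ T, Share ends e e' → e = e' := by
  constructor
  · rintro ⟨-, h⟩ e he e' he' ⟨v, hv, hv'⟩
    by_contra hne
    exact h _ ⟨e, he, rfl⟩ _ ⟨e', he', rfl⟩ (hinj.ne hne) v hv hv'
  · intro h
    refine ⟨hran ▸ Set.image_subset_range _ _, ?_⟩
    rintro _ ⟨e, he, rfl⟩ _ ⟨e', he', rfl⟩ hne v hv hv'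
    exact hne (congrArg ends (h e he e' he' ⟨v, hv, hv'⟩))

lemma isInducedMatching_image_iff (hinj : ends.Injective)
    (hran : Set.range ends = G.edgeSet) (T : Set E) :
    IsInducedMatching G (ends '' T) ↔
      ∀ e ∈ T, ∀ e' ∈ T, ∀ f, Share ends f e → Share ends f e' → e = e' := by
  constructor
  · rintro ⟨-, h⟩ e he e' he' f hf hf'
    by_contra hne
    exact (h _ ⟨e, he, rfl⟩ _ ⟨e', he', rfl⟩ (hinj.ne hne)).2 (ends f)
      (hran ▸ Set.mem_range_self f) ⟨hf, hf'⟩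
  · intro h
    refine ⟨hran ▸ Set.image_subset_range _ _, ?_⟩
    rintro _ ⟨e, he, rfl⟩ _ ⟨e', he', rfl⟩ hne
    refine ⟨fun v hv hv' => hne (congrArg ends (h e he e' he' e (share_self e) ⟨v, hv, hv'⟩)),
      fun f hf hff => ?_⟩
    rw [← hran] at hf
    obtain ⟨f, rfl⟩ := hf
    exact hne (congrArg ends (h e he e' he' f hff.1 hff.2))

lemma isMaximalMatching_image_iff (hinj : ends.Injective)
    (hran : Set.range ends = G.edgeSet) (T : Set E) :
    IsMaximalMatching G (ends '' T) ↔
      (∀ e ∈ T, ∀ e' ∈ T, Share ends e e' → e = e') ∧ ∀ f, ∃ e ∈ T, Share ends f e := by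
  rw [IsMaximalMatching, isMatching_image_iff hinj hran]
  refine and_congr_right fun hT => ⟨fun h f => ?_, fun h M' hM' hsub => ?_⟩
  · by_contra! hf
    have hm : IsMatching G (ends '' (insert f T)) := by
      rw [isMatching_image_iff hinj hran]
      rintro e (rfl | he) e' (rfl | he') hs
      · rfl
      · exact (hf _ he' hs).elim
      · exact (hf _ he (hs.imp fun _ => And.symm)).elim
      · exact hT e he e' he' hs
    have heq := h _ hm (Set.image_mono (Set.subset_insert f T))
    have hmem : ends f ∈ ends '' T := heq ▸ ⟨f, Set.mem_insert f T, rfl⟩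
    exact hf f ((hinj.mem_set_image).1 hmem) (share_self f)
  · refine hsub.antisymm' fun m hm => ?_
    obtain ⟨f, rfl⟩ : m ∈ Set.range ends := hran ▸ hM'.1 hm
    obtain ⟨e, he, v, hv, hv'⟩ := h f
    by_cases hfe : ends f = ends e
    · exact ⟨e, he, hfe.symm⟩
    · exact (hM'.2 _ hm _ (hsub ⟨e, he, rfl⟩) hfe v hv hv').elim

lemma exists_finset_image_eq [Finite E] (hinj : ends.Injective)
    (hran : Set.range ends = G.edgeSet) {M : Set (Sym2 V)} (hM : M ⊆ G.edgeSet) :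
    ∃ T : Finset E, ends '' (T : Set E) = M ∧ M.ncard = T.card := by
  have hT : ends '' ((Set.toFinite (ends ⁻¹' M)).toFinset : Set E) = M := by
    rw [Set.Finite.coe_toFinset, Set.image_preimage_eq_of_subset (hran ▸ hM)]
  refine ⟨_, hT, ?_⟩
  conv_lhs => rw [← hT]
  rw [Set.ncard_image_of_injective _ hinj, Set.ncard_coe_finset]

end EdgeParametrization

/-- Labels of the edges of `G_{a,b}`: in each block, the edges of the attached cycle in
cyclic order starting at `y_i`, followed by the edge joining `y_i` to the centre. -/
abbrev Eab (a b : ℕ) := (Fin (a + 1) × Fin 6) ⊕ (Fin b × Fin 5)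

/-- The vertices of the `i`-th block with a 5-cycle, preceded by the centre. -/
def block5 {a b : ℕ} (i : Fin (a + 1)) : Fin 6 → Vab a b :=
  ![vabx, vaby (y5 i), vab5 i 0, vab5 i 1, vab5 i 2, vab5 i 3]

/-- The vertices of the `i`-th block with a 4-cycle, preceded by the centre. -/
def block4 {a b : ℕ} (i : Fin b) : Fin 5 → Vab a b :=
  ![vabx, vaby (y4 i), vab4 i 0, vab4 i 1, vab4 i 2]

/-- The edges of a 5-cycle with a pendant edge. -/
def local5 : Fin 6 → Sym2 (Fin 6) := ![s(1, 2), s(2, 3), s(3, 4), s(4, 5), s(5, 1), s(0, 1)]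

/-- The edges of a 4-cycle with a pendant edge. -/
def local4 : Fin 5 → Sym2 (Fin 5) := ![s(1, 2), s(2, 3), s(3, 4), s(4, 1), s(0, 1)]

/-- The edge of `G_{a,b}` with a given label. -/
def endsab {a b : ℕ} : Eab a b → Sym2 (Vab a b)
  | .inl (i, k) => (local5 k).map (block5 i)
  | .inr (i, k) => (local4 k).map (block4 i)

variable {a b : ℕ}

lemma block5_eq_block5 {i j : Fin (a + 1)} {p q : Fin 6} :
    (block5 i p : Vab a b) = block5 j q ↔ p = q ∧ (p = 0 ∨ i = j) := by
  fin_cases p <;> fin_cases q <;>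
    simp [block5, vabx, vaby, vab5, y5, Fin.ext_iff]

lemma block4_eq_block4 {i j : Fin b} {p q : Fin 5} :
    (block4 i p : Vab a b) = block4 j q ↔ p = q ∧ (p = 0 ∨ i = j) := by
  fin_cases p <;> fin_cases q <;>
    simp [block4, vabx, vaby, vab4, y4, Fin.ext_iff]

lemma block5_eq_block4 {i : Fin (a + 1)} {j : Fin b} {p : Fin 6} {q : Fin 5} :
    (block5 i p : Vab a b) = block4 j q ↔ p = 0 ∧ q = 0 := by
  fin_cases p <;> fin_cases q <;>
    simp [block5, block4, vabx, vaby, vab5, vab4, y5, y4]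
  omega

lemma zero_mem_local5 : ∀ k, (0 : Fin 6) ∈ local5 k ↔ k = 5 := by decide

lemma zero_mem_local4 : ∀ k, (0 : Fin 5) ∈ local4 k ↔ k = 4 := by decide

lemma share_inl_inl {i j : Fin (a + 1)} {k l : Fin 6} :
    Share (endsab (a := a) (b := b)) (.inl (i, k)) (.inl (j, l)) ↔
      (k = 5 ∧ l = 5) ∨ (i = j ∧ Share local5 k l) := by
  simp only [Share, endsab, Sym2.mem_map, ← zero_mem_local5]
  constructor
  · rintro ⟨_, ⟨p, hp, rfl⟩, q, hq, h⟩
    obtain ⟨rfl, rfl | rfl⟩ := block5_eq_block5.1 h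
    · exact .inl ⟨hp, hq⟩
    · exact .inr ⟨rfl, _, hp, hq⟩
  · rintro (⟨hp, hq⟩ | ⟨rfl, p, hp, hq⟩)
    · exact ⟨_, ⟨0, hp, rfl⟩, 0, hq, rfl⟩
    · exact ⟨_, ⟨p, hp, rfl⟩, p, hq, rfl⟩

lemma share_inr_inr {i j : Fin b} {k l : Fin 5} :
    Share (endsab (a := a) (b := b)) (.inr (i, k)) (.inr (j, l)) ↔
      (k = 4 ∧ l = 4) ∨ (i = j ∧ Share local4 k l) := by
  simp only [Share, endsab, Sym2.mem_map, ← zero_mem_local4]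
  constructor
  · rintro ⟨_, ⟨p, hp, rfl⟩, q, hq, h⟩
    obtain ⟨rfl, rfl | rfl⟩ := block4_eq_block4.1 h
    · exact .inl ⟨hp, hq⟩
    · exact .inr ⟨rfl, _, hp, hq⟩
  · rintro (⟨hp, hq⟩ | ⟨rfl, p, hp, hq⟩)
    · exact ⟨_, ⟨0, hp, rfl⟩, 0, hq, rfl⟩
    · exact ⟨_, ⟨p, hp, rfl⟩, p, hq, rfl⟩

lemma share_inl_inr {i : Fin (a + 1)} {j : Fin b} {k : Fin 6} {l : Fin 5} :
    Share (endsab (a := a) (b := b)) (.inl (i, k)) (.inr (j, l)) ↔ k = 5 ∧ l = 4 := by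
  simp only [Share, endsab, Sym2.mem_map, ← zero_mem_local5, ← zero_mem_local4]
  constructor
  · rintro ⟨_, ⟨p, hp, rfl⟩, q, hq, h⟩
    obtain ⟨rfl, rfl⟩ := block5_eq_block4.1 h.symm
    exact ⟨hp, hq⟩
  · rintro ⟨hp, hq⟩
    exact ⟨_, ⟨0, hp, rfl⟩, 0, hq, rfl⟩

lemma share_inr_inl {i : Fin (a + 1)} {j : Fin b} {k : Fin 6} {l : Fin 5} :
    Share (endsab (a := a) (b := b)) (.inr (j, l)) (.inl (i, k)) ↔ k = 5 ∧ l = 4 := by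
  rw [← share_inl_inr (i := i) (j := j)]
  exact exists_congr fun _ => and_comm

instance {m n : ℕ} (f : Fin m → Sym2 (Fin n)) (k l : Fin m) : Decidable (Share f k l) :=
  inferInstanceAs (Decidable (∃ v, v ∈ f k ∧ v ∈ f l))

lemma local5_injective : local5.Injective := by decide

lemma local4_injective : local4.Injective := by decide

lemma endsab_injective : (endsab (a := a) (b := b)).Injective := by
  have h5 : ∀ k, ∃ p ∈ local5 k, p ≠ 0 := by decide
  have h4 : ∀ k, ∃ p ∈ local4 k, p ≠ 0 := by decide
  have i5 (i : Fin (a + 1)) : (block5 (b := b) i).Injective := fun p q h =>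
    (block5_eq_block5.1 h).1
  have i4 (i : Fin b) : (block4 (a := a) i).Injective := fun p q h => (block4_eq_block4.1 h).1
  rintro (⟨i, k⟩ | ⟨i, k⟩) (⟨j, l⟩ | ⟨j, l⟩) h <;> simp only [endsab] at h
  · obtain ⟨p, hp, hp0⟩ := h5 k
    obtain ⟨q, -, hq⟩ := Sym2.mem_map.1 (h ▸ Sym2.mem_map.2 ⟨p, hp, rfl⟩)
    obtain ⟨rfl, rfl | rfl⟩ := block5_eq_block5.1 hq
    · exact (hp0 rfl).elim
    · rw [local5_injective (Sym2.map.injective (i5 _) h)]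
  · obtain ⟨p, hp, hp0⟩ := h5 k
    obtain ⟨q, -, hq⟩ := Sym2.mem_map.1 (h ▸ Sym2.mem_map.2 ⟨p, hp, rfl⟩)
    exact (hp0 (block5_eq_block4.1 hq.symm).1).elim
  · obtain ⟨p, hp, hp0⟩ := h4 k
    obtain ⟨q, -, hq⟩ := Sym2.mem_map.1 (h ▸ Sym2.mem_map.2 ⟨p, hp, rfl⟩)
    exact (hp0 (block5_eq_block4.1 hq).2).elim
  · obtain ⟨p, hp, hp0⟩ := h4 k
    obtain ⟨q, -, hq⟩ := Sym2.mem_map.1 (h ▸ Sym2.mem_map.2 ⟨p, hp, rfl⟩)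
    obtain ⟨rfl, rfl | rfl⟩ := block4_eq_block4.1 hq
    · exact (hp0 rfl).elim
    · rw [local4_injective (Sym2.map.injective (i4 _) h)]

lemma range_endsab : Set.range (endsab (a := a) (b := b)) = (Gab a b).edgeSet := by
  rw [Gab, edgeSet_fromEdgeSet]
  ext e
  constructor
  · rintro ⟨⟨i, k⟩ | ⟨i, k⟩, rfl⟩
    · refine ⟨?_, ?_⟩
      · fin_cases k
        on_goal 6 => exact .inl (.inl ⟨y5 i, rfl⟩)
        all_goals exact .inl (.inr ⟨i, by simp [endsab, local5, block5]⟩)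
      · fin_cases k <;> simp [endsab, local5, block5, vabx, vaby, vab5]
    · refine ⟨?_, ?_⟩
      · fin_cases k
        on_goal 5 => exact .inl (.inl ⟨y4 i, rfl⟩)
        all_goals exact .inr ⟨i, by simp [endsab, local4, block4]⟩
      · fin_cases k <;> simp [endsab, local4, block4, vabx, vaby, vab4]
  · rintro ⟨(⟨i, rfl⟩ | ⟨i, rfl | rfl | rfl | rfl | rfl⟩) | ⟨i, rfl | rfl | rfl | rfl⟩, -⟩
    · by_cases h : i.1 < a + 1
      · exact ⟨.inl (⟨i, h⟩, 5), rfl⟩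
      · refine ⟨.inr (⟨i - (a + 1), by omega⟩, 4), ?_⟩
        have : y4 ⟨i - (a + 1), by omega⟩ = i := by
          ext
          simp only [y4]
          omega
        simp [endsab, local4, block4, this]
    · exact ⟨.inl (i, 0), rfl⟩
    · exact ⟨.inl (i, 1), rfl⟩
    · exact ⟨.inl (i, 2), rfl⟩
    · exact ⟨.inl (i, 3), rfl⟩
    · exact ⟨.inl (i, 4), rfl⟩
    · exact ⟨.inr (i, 0), rfl⟩
    · exact ⟨.inr (i, 1), rfl⟩
    · exact ⟨.inr (i, 2), rfl⟩
    · exact ⟨.inr (i, 3), rfl⟩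

lemma card_eq_sum_blocks (T : Finset (Eab a b)) :
    T.card = ∑ i, ({k | .inl (i, k) ∈ T} : Finset (Fin 6)).card +
      ∑ j, ({k | .inr (j, k) ∈ T} : Finset (Fin 5)).card := by
  simp only [Finset.card_filter, ← Fintype.sum_prod_type', Prod.mk.eta]
  rw [← Fintype.sum_sum_type (fun e => if e ∈ T then 1 else 0)]
  simp

/-- The edges at the centre of the star. -/
def IsSpoke : Eab a b → Prop
  | .inl (_, k) => k = 5
  | .inr (_, k) => k = 4

instance : DecidablePred (IsSpoke (a := a) (b := b))
  | .inl (_, k) => inferInstanceAs (Decidable (k = 5))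
  | .inr (_, k) => inferInstanceAs (Decidable (k = 4))

lemma IsSpoke.share {e f : Eab a b} (he : IsSpoke e) (hf : IsSpoke f) :
    Share endsab e f := by
  rcases e with ⟨i, k⟩ | ⟨i, k⟩ <;> rcases f with ⟨j, l⟩ | ⟨j, l⟩ <;>
    simp_all [IsSpoke, share_inl_inl, share_inl_inr, share_inr_inl, share_inr_inr]

lemma card_le_of_blocks {T : Finset (Eab a b)} {c : ℕ}
    (hT : ∀ e ∈ T, ∀ f ∈ T, Share endsab e f → e = f)
    (h5 : ∀ i, ({k | k ≠ 5 ∧ .inl (i, k) ∈ T} : Finset (Fin 6)).card ≤ c)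
    (h4 : ∀ j, ({k | k ≠ 4 ∧ .inr (j, k) ∈ T} : Finset (Fin 5)).card ≤ c) :
    T.card ≤ (a + 1) * c + b * c + 1 := by
  have hs : (T.filter IsSpoke).card ≤ 1 := by
    rw [Finset.card_le_one]
    intro e he f hf
    rw [Finset.mem_filter] at he hf
    exact hT e he.1 f hf.1 (he.2.share hf.2)
  have hn : (T.filter (¬ IsSpoke ·)).card ≤ (a + 1) * c + b * c := by
    rw [card_eq_sum_blocks]
    refine add_le_add ((Finset.sum_le_sum fun i _ => (?_ : _ ≤ c)).trans (by simp))
      ((Finset.sum_le_sum fun i _ => (?_ : _ ≤ c)).trans (by simp))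
    · refine (Finset.card_le_card fun k hk => ?_).trans (h5 i)
      simp only [Finset.mem_filter, Finset.mem_univ, true_and] at hk ⊢
      exact hk.symm
    · refine (Finset.card_le_card fun k hk => ?_).trans (h4 i)
      simp only [Finset.mem_filter, Finset.mem_univ, true_and] at hk ⊢
      exact hk.symm
  rw [← Finset.card_filter_add_card_filter_not (s := T) IsSpoke]
  omega

lemma card_le_two_of_local5 : ∀ S : Finset (Fin 6), 5 ∉ S →
    (∀ k ∈ S, ∀ l ∈ S, Share local5 k l → k = l) → S.card ≤ 2 := by decide

lemma card_le_two_of_local4 : ∀ S : Finset (Fin 5), 4 ∉ S →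
    (∀ k ∈ S, ∀ l ∈ S, Share local4 k l → k = l) → S.card ≤ 2 := by decide

lemma exists_share_local5 : ∀ k l : Fin 6, k ≠ 5 → l ≠ 5 →
    ∃ f, Share local5 f k ∧ Share local5 f l := by decide

lemma exists_share_local4 : ∀ k l : Fin 5, k ≠ 4 → l ≠ 4 →
    ∃ f, Share local4 f k ∧ Share local4 f l := by decide

lemma two_le_card_of_local5 : ∀ S : Finset (Fin 6),
    (∀ f, f ≠ 5 → ∃ k ∈ S, Share local5 f k) → 2 ≤ S.card := by decide

lemma two_le_card_of_local4 : ∀ S : Finset (Fin 5),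
    (∀ f, f ≠ 4 → ∃ k ∈ S, Share local4 f k) → 2 ≤ S.card := by decide

lemma card_le_of_matching {T : Finset (Eab a b)}
    (hT : ∀ e ∈ T, ∀ f ∈ T, Share endsab e f → e = f) : T.card ≤ 2 * a + 2 * b + 3 := by
  have := card_le_of_blocks (c := 2) hT
    (fun i => card_le_two_of_local5 _ (by simp) fun k hk l hl h => by
      simpa using hT _ (Finset.mem_filter.1 hk).2.2 _ (Finset.mem_filter.1 hl).2.2
        (share_inl_inl.2 (.inr ⟨rfl, h⟩)))
    (fun i => card_le_two_of_local4 _ (by simp) fun k hk l hl h => by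
      simpa using hT _ (Finset.mem_filter.1 hk).2.2 _ (Finset.mem_filter.1 hl).2.2
        (share_inr_inr.2 (.inr ⟨rfl, h⟩)))
  omega

lemma card_le_of_inducedMatching {T : Finset (Eab a b)}
    (hT : ∀ e ∈ T, ∀ e' ∈ T, ∀ f, Share endsab f e → Share endsab f e' → e = e') :
    T.card ≤ a + b + 2 := by
  have := card_le_of_blocks (c := 1) (fun e he f hf h => hT e he f hf e (share_self e) h)
    (fun i => Finset.card_le_one.2 fun k hk l hl => by
      rw [Finset.mem_filter] at hk hl
      obtain ⟨f, hfk, hfl⟩ := exists_share_local5 k l hk.2.1 hl.2.1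
      simpa using hT _ hk.2.2 _ hl.2.2 (.inl (i, f)) (share_inl_inl.2 (.inr ⟨rfl, hfk⟩))
        (share_inl_inl.2 (.inr ⟨rfl, hfl⟩)))
    (fun i => Finset.card_le_one.2 fun k hk l hl => by
      rw [Finset.mem_filter] at hk hl
      obtain ⟨f, hfk, hfl⟩ := exists_share_local4 k l hk.2.1 hl.2.1
      simpa using hT _ hk.2.2 _ hl.2.2 (.inr (i, f)) (share_inr_inr.2 (.inr ⟨rfl, hfk⟩))
        (share_inr_inr.2 (.inr ⟨rfl, hfl⟩)))
  omega

lemma le_card_of_dominating {T : Finset (Eab a b)}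
    (hT : ∀ f, ∃ e ∈ T, Share endsab f e) : 2 * a + 2 * b + 2 ≤ T.card := by
  have h5 (i : Fin (a + 1)) : 2 ≤ ({k | .inl (i, k) ∈ T} : Finset (Fin 6)).card := by
    refine two_le_card_of_local5 _ fun f hf => ?_
    obtain ⟨⟨j, k⟩ | ⟨j, k⟩, hk, hs⟩ := hT (.inl (i, f))
    · obtain ⟨h, -⟩ | ⟨rfl, h⟩ := share_inl_inl.1 hs
      · exact (hf h).elim
      · exact ⟨k, by simpa using hk, h⟩
    · exact (hf (share_inl_inr.1 hs).1).elim
  have h4 (i : Fin b) : 2 ≤ ({k | .inr (i, k) ∈ T} : Finset (Fin 5)).card := by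
    refine two_le_card_of_local4 _ fun f hf => ?_
    obtain ⟨⟨j, k⟩ | ⟨j, k⟩, hk, hs⟩ := hT (.inr (i, f))
    · exact (hf (share_inr_inl.1 hs).2).elim
    · obtain ⟨h, -⟩ | ⟨rfl, h⟩ := share_inr_inr.1 hs
      · exact (hf h).elim
      · exact ⟨k, by simpa using hk, h⟩
  have s5 := Finset.sum_le_sum fun i (_ : i ∈ Finset.univ) => h5 i
  have s4 := Finset.sum_le_sum fun i (_ : i ∈ Finset.univ) => h4 i
  simp only [Finset.sum_const, Finset.card_univ, Fintype.card_fin, smul_eq_mul] at s5 s4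
  rw [card_eq_sum_blocks]
  omega

/-- The set of labels made of the local edges `S i` in the `i`-th block with a 5-cycle, and
`R` in every block with a 4-cycle. -/
def ofBlocks (b : ℕ) (S : Fin (a + 1) → Finset (Fin 6)) (R : Finset (Fin 5)) :
    Finset (Eab a b) :=
  (Finset.univ.filter fun e : Fin (a + 1) × Fin 6 => e.2 ∈ S e.1).disjSum
    (Finset.univ ×ˢ R)

@[simp]
lemma inl_mem_ofBlocks {S : Fin (a + 1) → Finset (Fin 6)} {R : Finset (Fin 5)}
    {i : Fin (a + 1)} {k : Fin 6} : .inl (i, k) ∈ ofBlocks b S R ↔ k ∈ S i := by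
  simp [ofBlocks]

@[simp]
lemma inr_mem_ofBlocks {S : Fin (a + 1) → Finset (Fin 6)} {R : Finset (Fin 5)}
    {i : Fin b} {k : Fin 5} : .inr (i, k) ∈ ofBlocks b S R ↔ k ∈ R := by
  simp [ofBlocks]

lemma card_ofBlocks (S : Fin (a + 1) → Finset (Fin 6)) (R : Finset (Fin 5)) :
    (ofBlocks b S R).card = ∑ i, (S i).card + b * R.card := by
  simp [card_eq_sum_blocks]

/-- A minimum maximal matching. -/
def minMaximalSet (a b : ℕ) : Finset (Eab a b) := ofBlocks b (fun _ => {0, 2}) {0, 2}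

/-- A maximum matching. -/
def maxSet (a b : ℕ) : Finset (Eab a b) :=
  ofBlocks b (fun i => if i = 0 then {1, 3, 5} else {0, 2}) {0, 2}

/-- A maximum induced matching. -/
def inducedSet (a b : ℕ) : Finset (Eab a b) :=
  ofBlocks b (fun i => if i = 0 then {2, 5} else {2}) {1}

lemma card_minMaximalSet : (minMaximalSet a b).card = 2 * a + 2 * b + 2 := by
  simp [minMaximalSet, card_ofBlocks]
  ring

lemma card_maxSet : (maxSet a b).card = 2 * a + 2 * b + 3 := by
  rw [maxSet, card_ofBlocks, Fin.sum_univ_succ]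
  simp [Fin.succ_ne_zero]
  ring

lemma card_inducedSet : (inducedSet a b).card = a + b + 2 := by
  rw [inducedSet, card_ofBlocks, Fin.sum_univ_succ]
  simp [Fin.succ_ne_zero]
  ring

lemma matching_ofBlocks {S : Fin (a + 1) → Finset (Fin 6)} {R : Finset (Fin 5)}
    (hS : ∀ i, ∀ k ∈ S i, ∀ l ∈ S i, Share local5 k l → k = l)
    (hR : ∀ k ∈ R, ∀ l ∈ R, Share local4 k l → k = l)
    (hspoke : ∀ i, 5 ∈ S i → i = 0) (hR4 : 4 ∉ R) :
    ∀ e ∈ ofBlocks b S R, ∀ f ∈ ofBlocks b S R, Share endsab e f → e = f := by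
  rintro (⟨i, k⟩ | ⟨i, k⟩) he (⟨j, l⟩ | ⟨j, l⟩) hf h
  · rw [inl_mem_ofBlocks] at he hf
    obtain ⟨rfl, rfl⟩ | ⟨rfl, hs⟩ := share_inl_inl.1 h
    · rw [hspoke i he, hspoke j hf]
    · rw [hS i k he l hf hs]
  · rw [inr_mem_ofBlocks] at hf
    obtain ⟨rfl, rfl⟩ := share_inl_inr.1 h
    exact (hR4 hf).elim
  · rw [inr_mem_ofBlocks] at he
    obtain ⟨rfl, rfl⟩ := share_inr_inl.1 h
    exact (hR4 he).elim
  · rw [inr_mem_ofBlocks] at he hf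
    obtain ⟨rfl, rfl⟩ | ⟨rfl, hs⟩ := share_inr_inr.1 h
    · exact (hR4 he).elim
    · rw [hR k he l hf hs]

lemma matching_minMaximalSet :
    ∀ e ∈ minMaximalSet a b, ∀ f ∈ minMaximalSet a b, Share endsab e f → e = f :=
  matching_ofBlocks (fun _ => by decide) (by decide) (by simp) (by decide)

lemma matching_maxSet : ∀ e ∈ maxSet a b, ∀ f ∈ maxSet a b, Share endsab e f → e = f := by
  refine matching_ofBlocks (fun i => ?_) (by decide) (fun i hi => ?_) (by decide)
  · split_ifs <;> decide
  · by_contra h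
    simp [h] at hi

lemma dominating_minMaximalSet (f : Eab a b) :
    ∃ e ∈ minMaximalSet a b, Share endsab f e := by
  have h5 : ∀ k, ∃ l ∈ ({0, 2} : Finset (Fin 6)), Share local5 k l := by decide
  have h4 : ∀ k, ∃ l ∈ ({0, 2} : Finset (Fin 5)), Share local4 k l := by decide
  rcases f with ⟨i, k⟩ | ⟨i, k⟩
  · obtain ⟨l, hl, h⟩ := h5 k
    exact ⟨.inl (i, l), inl_mem_ofBlocks.2 hl, share_inl_inl.2 (.inr ⟨rfl, h⟩)⟩
  · obtain ⟨l, hl, h⟩ := h4 k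
    exact ⟨.inr (i, l), inr_mem_ofBlocks.2 hl, share_inr_inr.2 (.inr ⟨rfl, h⟩)⟩

lemma induced_inducedSet : ∀ e ∈ inducedSet a b, ∀ e' ∈ inducedSet a b,
    ∀ f, Share endsab f e → Share endsab f e' → e = e' := by
  have h25 : ∀ k, Share local5 k 2 → ¬ Share local5 k 5 := by decide
  have h52 : ¬ Share local5 5 2 := by decide
  have h41 : ¬ Share local4 4 1 := by decide
  have hmem (i : Fin (a + 1)) (k : Fin 6) (hk : .inl (i, k) ∈ inducedSet a b) :
      k = 2 ∨ (k = 5 ∧ i = 0) := by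
    rw [inducedSet, inl_mem_ofBlocks] at hk
    split_ifs at hk <;> simp_all
  have hmem' (i : Fin b) (k : Fin 5) (hk : .inr (i, k) ∈ inducedSet a b) : k = 1 := by
    simpa [inducedSet] using hk
  rintro (⟨i, k⟩ | ⟨i, k⟩) he (⟨j, l⟩ | ⟨j, l⟩) he' (⟨m, f⟩ | ⟨m, f⟩) h h' <;>
    simp only [share_inl_inl, share_inl_inr, share_inr_inl, share_inr_inr] at h h'
  all_goals first
    | have hk := hmem _ _ he
    | have hk := hmem' _ _ he
  all_goals first
    | have hl := hmem _ _ he'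
    | have hl := hmem' _ _ he'
  all_goals grind

/-- the invariants of the graph `G_{a,b}`. -/
theorem Gab_invariants (a b : ℕ) :
    indMatchNum (Gab a b) = a + b + 2 ∧
    minMatchNum (Gab a b) = 2 * a + 2 * b + 2 ∧
    matchNum (Gab a b) = 2 * a + 2 * b + 3 := by
  have hinj := endsab_injective (a := a) (b := b)
  have hran := range_endsab (a := a) (b := b)
  have hcard (T : Finset (Eab a b)) : (endsab '' (T : Set (Eab a b))).ncard = T.card := by
    rw [Set.ncard_image_of_injective _ hinj, Set.ncard_coe_finset]
  refine ⟨IsGreatest.csSup_eq ⟨⟨_, ?_, (hcard (inducedSet a b)).trans card_inducedSet⟩, ?_⟩,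
    IsLeast.csInf_eq ⟨⟨_, ?_, (hcard (minMaximalSet a b)).trans card_minMaximalSet⟩, ?_⟩,
    IsGreatest.csSup_eq ⟨⟨_, ?_, (hcard (maxSet a b)).trans card_maxSet⟩, ?_⟩⟩
  · exact (isInducedMatching_image_iff hinj hran _).2 induced_inducedSet
  · rintro _ ⟨M, hM, rfl⟩
    obtain ⟨T, rfl, h⟩ := exists_finset_image_eq hinj hran hM.1
    exact h ▸ card_le_of_inducedMatching ((isInducedMatching_image_iff hinj hran _).1 hM)
  · exact (isMaximalMatching_image_iff hinj hran _).2
      ⟨matching_minMaximalSet, dominating_minMaximalSet⟩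
  · rintro _ ⟨M, hM, rfl⟩
    obtain ⟨T, rfl, h⟩ := exists_finset_image_eq hinj hran hM.1.1
    exact h ▸ le_card_of_dominating ((isMaximalMatching_image_iff hinj hran _).1 hM).2
  · exact (isMatching_image_iff hinj hran _).2 matching_maxSet
  · rintro _ ⟨M, hM, rfl⟩
    obtain ⟨T, rfl, h⟩ := exists_finset_image_eq hinj hran hM.1
    exact h ▸ card_le_of_matching ((isMatching_image_iff hinj hran _).1 hM)

end DIM
end

section
/- For every integer k ≥ 2, let H_k be the graph on the vertex set {u, v, x_1, …, x_k, y_1, …, y_k, z_{11}, z_{12}, …, z_{k1}, z_{k2}} whose edges are {u, x_i}, {v, y_i}, {x_i, z_{i1}}, {x_i, z_{i2}}, {y_i, z_{i1}}, {y_i, z_{i2}} for i = 1, 2, …, k. Then ind-match(H_k) = k and min-match(H_k) = match(H_k) = 2k. -/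
namespace DIM

open SimpleGraph

variable {V : Type*}

/-- Vertex set of the graph `H_k`: `u`, `v`, `x_1, …, x_k`, `y_1, …, y_k` and
`z_{i1}, z_{i2}` for `i = 1, …, k`. -/
abbrev VHk (k : ℕ) := Unit ⊕ Unit ⊕ Fin k ⊕ Fin k ⊕ (Fin k × Fin 2)

def hku {k : ℕ} : VHk k := Sum.inl ()
def hkv {k : ℕ} : VHk k := Sum.inr (Sum.inl ())
def hkx {k : ℕ} (i : Fin k) : VHk k := Sum.inr (Sum.inr (Sum.inl i))
def hky {k : ℕ} (i : Fin k) : VHk k := Sum.inr (Sum.inr (Sum.inr (Sum.inl i)))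
def hkz {k : ℕ} (i : Fin k) (t : Fin 2) : VHk k :=
  Sum.inr (Sum.inr (Sum.inr (Sum.inr (i, t))))

/-- The graph `H_k`, with edges `{u, x_i}`, `{v, y_i}`, `{x_i, z_{i1}}`, `{x_i, z_{i2}}`,
`{y_i, z_{i1}}`, `{y_i, z_{i2}}` for `i = 1, …, k`. -/
def Hk (k : ℕ) : SimpleGraph (VHk k) :=
  SimpleGraph.fromEdgeSet
    {e | ∃ i : Fin k,
      e = s(hku, hkx i) ∨ e = s(hkv, hky i) ∨
      e = s(hkx i, hkz i 0) ∨ e = s(hkx i, hkz i 1) ∨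
      e = s(hky i, hkz i 0) ∨ e = s(hky i, hkz i 1)}

/-- The hubs of `H_k`: `x_i` for `b = true` and `y_i` for `b = false`. -/
def hkHub {k : ℕ} (p : Fin k × Bool) : VHk k := if p.2 then hkx p.1 else hky p.1

/-- The apex adjacent to all hubs of a given kind: `u` for `b = true`, `v` for `b = false`. -/
def hkApex {k : ℕ} (b : Bool) : VHk k := if b then hku else hkv

theorem mem_edgeSet_Hk {k : ℕ} {e : Sym2 (VHk k)} :
    e ∈ (Hk k).edgeSet ↔ ∃ p : Fin k × Bool,
      e = s(hkHub p, hkApex p.2) ∨ ∃ t, e = s(hkHub p, hkz p.1 t) := by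
  simp only [Hk, edgeSet_fromEdgeSet, Set.mem_sdiff, Set.mem_ofPred_eq, Prod.exists,
    Bool.exists_bool, hkHub, hkApex, Fin.exists_fin_two, if_true, Bool.false_eq_true, if_false]
  constructor
  · rintro ⟨⟨i, h⟩, -⟩
    refine ⟨i, ?_⟩
    rw [Sym2.eq_swap (a := hkx i) (b := hku), Sym2.eq_swap (a := hky i) (b := hkv)]
    tauto
  · rintro ⟨i, h⟩
    rw [Sym2.eq_swap (a := hkx i) (b := hku), Sym2.eq_swap (a := hky i) (b := hkv)] at h
    refine ⟨⟨i, by tauto⟩, ?_⟩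
    rcases h with (rfl | rfl | rfl) | (rfl | rfl | rfl) <;> simp [hku, hkv, hkx, hky, hkz]

theorem hkHub_mem_apex_edge {k : ℕ} {p q : Fin k × Bool} {b : Bool} :
    hkHub p ∈ s(hkHub q, hkApex b) ↔ p = q := by
  obtain ⟨i, _ | _⟩ := p <;> obtain ⟨j, _ | _⟩ := q <;> cases b <;>
    simp [hkHub, hkApex, hku, hkv, hkx, hky]

theorem hkHub_mem_z_edge {k : ℕ} {p q : Fin k × Bool} {i : Fin k} {t : Fin 2} :
    hkHub p ∈ s(hkHub q, hkz i t) ↔ p = q := by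
  obtain ⟨i, _ | _⟩ := p <;> obtain ⟨j, _ | _⟩ := q <;>
    simp [hkHub, hkx, hky, hkz]

theorem hkz_mem_apex_edge {k : ℕ} {q : Fin k × Bool} {b : Bool} {i : Fin k} {t : Fin 2} :
    hkz i t ∉ s(hkHub q, hkApex b) := by
  obtain ⟨j, _ | _⟩ := q <;> cases b <;> simp [hkHub, hkApex, hku, hkv, hkx, hky, hkz]

theorem hkz_mem_z_edge {k : ℕ} {q : Fin k × Bool} {i j : Fin k} {t s : Fin 2} :
    hkz i t ∈ s(hkHub q, hkz j s) ↔ i = j ∧ t = s := by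
  obtain ⟨l, _ | _⟩ := q <;> simp [hkHub, hkx, hky, hkz]

theorem existsUnique_hkHub_mem {k : ℕ} {e : Sym2 (VHk k)} (he : e ∈ (Hk k).edgeSet) :
    ∃! p, hkHub p ∈ e := by
  obtain ⟨p, rfl | ⟨t, rfl⟩⟩ := mem_edgeSet_Hk.1 he
  · exact ⟨p, Sym2.mem_mk_left _ _, fun q hq => hkHub_mem_apex_edge.1 hq⟩
  · exact ⟨p, Sym2.mem_mk_left _ _, fun q hq => hkHub_mem_z_edge.1 hq⟩

theorem IsMatching.eq_of_mem {G : SimpleGraph V} {M : Set (Sym2 V)} (hM : IsMatching G M)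
    {e e' : Sym2 V} (he : e ∈ M) (he' : e' ∈ M) {v : V} (hv : v ∈ e) (hv' : v ∈ e') : e = e' := by
  by_contra hne
  exact hM.2 e he e' he' hne v hv hv'

theorem IsInducedMatching.isMatching {G : SimpleGraph V} {M : Set (Sym2 V)}
    (hM : IsInducedMatching G M) : IsMatching G M :=
  ⟨hM.1, fun e he e' he' hne => (hM.2 e he e' he' hne).1⟩

theorem IsInducedMatching.eq_of_edge {G : SimpleGraph V} {M : Set (Sym2 V)}
    (hM : IsInducedMatching G M) {e e' : Sym2 V} (he : e ∈ M) (he' : e' ∈ M) {v w : V}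
    (h : s(v, w) ∈ G.edgeSet) (hv : v ∈ e) (hw : w ∈ e') : e = e' := by
  by_contra hne
  exact (hM.2 e he e' he' hne).2 _ h
    ⟨⟨v, Sym2.mem_mk_left _ _, hv⟩, ⟨w, Sym2.mem_mk_right _ _, hw⟩⟩

/-- A vertex of a maximal matching that is not covered has all its neighbours covered. -/
theorem IsMaximalMatching.exists_mem_of_adj {G : SimpleGraph V} {M : Set (Sym2 V)}
    (hM : IsMaximalMatching G M) {v w : V} (h : G.Adj v w) (hv : ∀ e ∈ M, v ∉ e) :
    ∃ e ∈ M, w ∈ e := by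
  by_contra! hw
  have hdisj : ∀ e ∈ M, ∀ a ∈ e, a ∉ s(v, w) := by
    intro e he a ha ha'
    rcases Sym2.mem_iff.1 ha' with rfl | rfl
    · exact hv e he ha
    · exact hw e he ha
  have hins : IsMatching G (insert s(v, w) M) := by
    refine ⟨Set.insert_subset h hM.1.1, ?_⟩
    rintro e (rfl | he) e' (rfl | he') hne a ha ha'
    · exact hne rfl
    · exact hdisj e' he' a ha' ha
    · exact hdisj e he a ha ha'
    · exact hM.1.2 e he e' he' hne a ha ha'
  have hmem : s(v, w) ∈ M := by
    rw [← hM.2 _ hins (Set.subset_insert _ _)]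
    exact Set.mem_insert _ _
  exact hv _ hmem (Sym2.mem_mk_left _ _)

theorem exists_isMaximalMatching [Finite V] (G : SimpleGraph V) :
    ∃ M, IsMaximalMatching G M := by
  obtain ⟨M, hM⟩ := (Set.toFinite {M | IsMatching G M}).exists_maximal
    ⟨∅, Set.empty_subset _, fun e he => he.elim⟩
  exact ⟨M, hM.1, fun M' hM' hle => (hM.2 hM' hle).antisymm hle⟩

theorem IsMatching.exists_injective_hkHub {k : ℕ} {M : Set (Sym2 (VHk k))}
    (hM : IsMatching (Hk k) M) :
    ∃ c : M → Fin k × Bool, (∀ e, hkHub (c e) ∈ e.1) ∧ Function.Injective c := by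
  have h : ∀ e : M, ∃ p, hkHub p ∈ e.1 := fun e => (existsUnique_hkHub_mem (hM.1 e.2)).exists
  choose c hc using h
  exact ⟨c, hc, fun e e' h => Subtype.ext (hM.eq_of_mem e.2 e'.2 (hc e) (h ▸ hc e'))⟩

theorem IsMatching.ncard_le_Hk {k : ℕ} {M : Set (Sym2 (VHk k))} (hM : IsMatching (Hk k) M) :
    M.ncard ≤ 2 * k := by
  obtain ⟨c, -, hinj⟩ := hM.exists_injective_hkHub
  simpa [mul_comm] using Nat.card_le_card_of_injective c hinj

theorem IsMaximalMatching.exists_hkHub_mem {k : ℕ} {M : Set (Sym2 (VHk k))}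
    (hM : IsMaximalMatching (Hk k) M) (p : Fin k × Bool) : ∃ e ∈ M, hkHub p ∈ e := by
  by_contra! hp
  have key : ∀ t, s(hkHub (p.1, !p.2), hkz p.1 t) ∈ M := by
    intro t
    obtain ⟨e, he, hz⟩ := hM.exists_mem_of_adj
      (show (Hk k).Adj (hkHub p) (hkz p.1 t) from mem_edgeSet_Hk.2 ⟨p, .inr ⟨t, rfl⟩⟩) hp
    obtain ⟨q, rfl | ⟨s, rfl⟩⟩ := mem_edgeSet_Hk.1 (hM.1.1 he)
    · exact (hkz_mem_apex_edge hz).elim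
    · obtain ⟨hi, rfl⟩ := hkz_mem_z_edge.1 hz
      have hne : p ≠ q := fun h => hp _ he (hkHub_mem_z_edge.2 h)
      have hq : (p.1, !p.2) = q := by
        refine Prod.ext hi ?_
        have : p.2 ≠ q.2 := fun h => hne (Prod.ext hi h)
        revert this
        cases p.2 <;> cases q.2 <;> simp
      rw [hq, hi]
      exact he
  have h01 := hM.1.eq_of_mem (key 0) (key 1) (Sym2.mem_mk_left _ _) (Sym2.mem_mk_left _ _)
  have hz : hkz p.1 0 ∈ s(hkHub (p.1, !p.2), hkz p.1 1) := h01 ▸ Sym2.mem_mk_right _ _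
  exact zero_ne_one (hkz_mem_z_edge.1 hz).2

theorem IsMaximalMatching.ncard_Hk {k : ℕ} {M : Set (Sym2 (VHk k))}
    (hM : IsMaximalMatching (Hk k) M) : M.ncard = 2 * k := by
  refine hM.1.ncard_le_Hk.antisymm ?_
  choose f hf hfp using hM.exists_hkHub_mem
  have hinj : Function.Injective f := fun p q h =>
    (existsUnique_hkHub_mem (hM.1.1 (hf p))).unique (hfp p) (h ▸ hfp q)
  have := Set.ncard_le_ncard_of_injOn (s := Set.univ) (t := M) f (fun p _ => hf p) hinj.injOn
  simpa [Set.ncard_univ, mul_comm] using this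

theorem IsInducedMatching.ncard_le_Hk {k : ℕ} (hk : 2 ≤ k) {M : Set (Sym2 (VHk k))}
    (hM : IsInducedMatching (Hk k) M) : M.ncard ≤ k := by
  obtain ⟨c, hc, hcinj⟩ := hM.isMatching.exists_injective_hkHub
  by_cases hinj : Function.Injective fun e => (c e).1
  · simpa using Nat.card_le_card_of_injective _ hinj
  · simp only [Function.Injective, not_forall] at hinj
    obtain ⟨e, e', hi, hne⟩ := hinj
    have hb : (c e).2 ≠ (c e').2 := fun h => hne (hcinj (Prod.ext hi h))
    have apex : ∀ a a' : M, (c a).1 = (c a').1 → a ≠ a' → hkApex (c a).2 ∈ a.1 := by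
      intro a a' hi hne
      have hca := hc a
      obtain ⟨q, h | ⟨t, h⟩⟩ := mem_edgeSet_Hk.1 (hM.1 a.2)
      · rw [h] at hca ⊢
        rw [hkHub_mem_apex_edge.1 hca]
        exact Sym2.mem_mk_right _ _
      · rw [h] at hca
        have hz : hkz (c a').1 t ∈ a.1 := by
          rw [← hi, hkHub_mem_z_edge.1 hca, h]
          exact Sym2.mem_mk_right _ _
        exact (hne (Subtype.ext (hM.eq_of_edge a'.2 a.2
          (mem_edgeSet_Hk.2 ⟨c a', .inr ⟨t, rfl⟩⟩) (hc a') hz).symm)).elim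
    have hsub : M ⊆ {e.1, e'.1} := by
      intro a ha
      have hedge : s(hkHub (c ⟨a, ha⟩), hkApex (c ⟨a, ha⟩).2) ∈ (Hk k).edgeSet :=
        mem_edgeSet_Hk.2 ⟨c ⟨a, ha⟩, .inl rfl⟩
      by_cases hae : (c ⟨a, ha⟩).2 = (c e).2
      · exact .inl (hM.eq_of_edge ha e.2 hedge (hc _) (hae ▸ apex e e' hi hne))
      · have hae' : (c ⟨a, ha⟩).2 = (c e').2 := by
          revert hae hb
          cases (c ⟨a, ha⟩).2 <;> cases (c e).2 <;> cases (c e').2 <;> simp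
        exact .inr (hM.eq_of_edge ha e'.2 hedge (hc _)
          (hae' ▸ apex e' e hi.symm (Ne.symm hne)))
    have hcard : ({e.1, e'.1} : Set (Sym2 (VHk k))).ncard = 2 :=
      Set.ncard_pair (Subtype.coe_injective.ne hne)
    exact (Set.ncard_le_ncard hsub).trans (hcard.le.trans hk)

theorem exists_isInducedMatching_Hk (k : ℕ) :
    ∃ M, IsInducedMatching (Hk k) M ∧ M.ncard = k := by
  have hinj : Function.Injective fun i : Fin k => s(hkHub (i, true), hkz i 0) := by
    intro i j h
    have : hkz i 0 ∈ s(hkHub (j, true), hkz j 0) := by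
      simp only at h
      exact h ▸ Sym2.mem_mk_right _ _
    exact (hkz_mem_z_edge.1 this).1
  refine ⟨Set.range fun i : Fin k => s(hkHub (i, true), hkz i 0), ⟨?_, ?_⟩, ?_⟩
  · rintro _ ⟨i, rfl⟩
    exact mem_edgeSet_Hk.2 ⟨(i, true), .inr ⟨0, rfl⟩⟩
  · rintro _ ⟨i, rfl⟩ _ ⟨j, rfl⟩ hne
    have hij : i ≠ j := fun h => hne (h ▸ rfl)
    refine ⟨?_, ?_⟩
    · intro v hv hv'
      simp only [Sym2.mem_iff] at hv hv'
      rcases hv with rfl | rfl <;> simp_all [hkHub, hkx, hkz]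
    · rintro f hf ⟨⟨v, hvf, hv⟩, ⟨w, hwf, hw⟩⟩
      simp only [Sym2.mem_iff] at hv hw
      obtain ⟨⟨l, b⟩, rfl | ⟨t, rfl⟩⟩ := mem_edgeSet_Hk.1 hf <;>
      simp only [Sym2.mem_iff] at hvf hwf <;>
      rcases hv with rfl | rfl <;> rcases hw with rfl | rfl <;> cases b <;>
        simp_all [hkHub, hkApex, hku, hkv, hkx, hky, hkz]
  · rw [← Set.image_univ, Set.ncard_image_of_injective _ hinj, Set.ncard_univ]
    simp

/-- for `k ≥ 2`, `ind-match(H_k) = k` and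
`min-match(H_k) = match(H_k) = 2k`. -/
theorem Hk_invariants (k : ℕ) (hk : 2 ≤ k) :
    indMatchNum (Hk k) = k ∧ minMatchNum (Hk k) = 2 * k ∧ matchNum (Hk k) = 2 * k := by
  obtain ⟨N, hN⟩ := exists_isMaximalMatching (Hk k)
  refine ⟨IsGreatest.csSup_eq ⟨exists_isInducedMatching_Hk k, ?_⟩,
    IsLeast.csInf_eq ⟨⟨N, hN, hN.ncard_Hk⟩, ?_⟩,
    IsGreatest.csSup_eq ⟨⟨N, hN.1, hN.ncard_Hk⟩, ?_⟩⟩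
  · rintro _ ⟨M, hM, rfl⟩
    exact hM.ncard_le_Hk hk
  · rintro _ ⟨M, hM, rfl⟩
    exact hM.ncard_Hk.ge
  · rintro _ ⟨M, hM, rfl⟩
    exact hM.ncard_le_Hk

end DIM
end

section
/- If a finite simple graph G possesses a dominating induced matching, then ind-match(G) = min-match(G). -/
namespace DIM

open SimpleGraph

variable {V : Type*}

/-- Every edge meets some edge of a maximal matching. -/
lemma IsMaximalMatching.exists_meets {G : SimpleGraph V} {N : Set (Sym2 V)}
    (hN : IsMaximalMatching G N) {e : Sym2 V} (he : e ∈ G.edgeSet) :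
    ∃ f ∈ N, ∃ v, v ∈ f ∧ v ∈ e := by
  by_contra! hc
  have hins : IsMatching G (insert e N) := by
    refine ⟨Set.insert_subset he hN.1.1, ?_⟩
    rintro a (rfl | ha) b (rfl | hb) hab v hva hvb
    · exact hab rfl
    · exact hc b hb v hvb hva
    · exact hc a ha v hva hvb
    · exact hN.1.2 a ha b hb hab v hva hvb
  have heN : e ∈ N := hN.2 _ hins (Set.subset_insert e N) ▸ Set.mem_insert e N
  exact hc e heN _ (Sym2.out_fst_mem e) (Sym2.out_fst_mem e)

/-- An induced matching has at most as many edges as any maximal matching. -/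
lemma IsInducedMatching.ncard_le {G : SimpleGraph V} [Finite V] {I N : Set (Sym2 V)}
    (hI : IsInducedMatching G I) (hN : IsMaximalMatching G N) : I.ncard ≤ N.ncard := by
  choose! f hfN hf using fun e (he : e ∈ I) => hN.exists_meets (hI.1 he)
  refine Set.ncard_le_ncard_of_injOn f hfN (fun a ha b hb hab => ?_) (Set.toFinite N)
  by_contra hne
  exact (hI.2 a ha b hb hne).2 (f a) (hN.1.1 (hfN a ha)) ⟨hf a ha, hab ▸ hf b hb⟩

/-- if `G` possesses a dominating induced matching, then
`ind-match(G) = min-match(G)`. -/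
theorem indMatchNum_eq_minMatchNum_of_hasDIM {V : Type*} [Fintype V] [DecidableEq V]
    (G : SimpleGraph V) (h : ∃ M : Set (Sym2 V), IsDIM G M) :
    indMatchNum G = minMatchNum G := by
  obtain ⟨M, hI, hM⟩ := h
  apply le_antisymm
  · refine csSup_le ⟨_, M, hI, rfl⟩ ?_
    rintro _ ⟨I, hI', rfl⟩
    refine le_csInf ⟨_, M, hM, rfl⟩ ?_
    rintro _ ⟨N, hN, rfl⟩
    exact hI'.ncard_le hN
  · have hmin : minMatchNum G ≤ M.ncard := Nat.sInf_le ⟨M, hM, rfl⟩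
    refine hmin.trans (le_csSup ⟨M.ncard, ?_⟩ ⟨M, hI, rfl⟩)
    rintro _ ⟨I, hI', rfl⟩
    exact hI'.ncard_le hM

end DIM
end

section
/- Let G be a finite simple graph on a vertex set V with a dominating induced matching, and let V = W ⊔ M be a decomposition where W is an independent set of G and the induced subgraph G_M consists of m pairwise disjoint edges {x_{j1}, x_{j2}}, j = 1, …, m. Let W_0 be the set of vertices of W that are not isolated in G, and let m_2 = #{ j : deg_G(x_{j1}) ≥ 2 and deg_G(x_{j2}) ≥ 2 }. If G is unmixed, then #W_0 ≤ 2·m_2. -/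
namespace DIM

open SimpleGraph

variable {V : Type*}

theorem isMinimalVertexCover_of_exists_adj_notMem {V : Type*} {G : SimpleGraph V} {C : Set V}
    (hC : IsVertexCover G C) (hpriv : ∀ v ∈ C, ∃ u, G.Adj v u ∧ u ∉ C) :
    IsMinimalVertexCover G C := by
  refine ⟨hC, fun C' hC' hcov => hC'.antisymm fun v hv => ?_⟩
  obtain ⟨u, hvu, hu⟩ := hpriv v hv
  exact (hcov hvu).resolve_right fun h => hu (hC' h)

theorem fin_two_eq_or_eq_add_one (k k' : Fin 2) : k' = k ∨ k' = k + 1 := by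
  revert k k'; decide

theorem fin_two_add_one_ne (k : Fin 2) : k + 1 ≠ k := by
  revert k; decide

theorem fin_two_add_one_add_one (k : Fin 2) : k + 1 + 1 = k := by
  revert k; decide

namespace IsDimDecomp

variable {V : Type*} {G : SimpleGraph V} {W : Set V} {m : ℕ} {x : Fin m → Fin 2 → V}

theorem eq_of_apply_eq (h : IsDimDecomp G W x) {j j' : Fin m} {k k' : Fin 2}
    (hx : x j k = x j' k') : j = j' ∧ k = k' := by
  have := @h.1 (j, k) (j', k') hx
  simpa using this

theorem notMem (h : IsDimDecomp G W x) (j : Fin m) (k : Fin 2) : x j k ∉ W :=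
  fun hW => (h.2.1 _).1 hW j k rfl

theorem mem_or_exists (h : IsDimDecomp G W x) (v : V) : v ∈ W ∨ ∃ j k, v = x j k := by
  by_contra! hv
  exact hv.1 ((h.2.1 v).2 hv.2)

theorem adj_add_one (h : IsDimDecomp G W x) (j : Fin m) (k : Fin 2) :
    G.Adj (x j k) (x j (k + 1)) := by
  rcases fin_two_eq_or_eq_add_one 0 k with rfl | rfl
  · exact h.2.2.2.1 j
  · exact (h.2.2.2.1 j).symm

/-- A neighbour of a matched vertex lies in `W` or is its partner. -/
theorem mem_or_eq_of_adj (h : IsDimDecomp G W x) {j : Fin m} {k : Fin 2} {v : V}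
    (hv : G.Adj (x j k) v) : v ∈ W ∨ v = x j (k + 1) := by
  refine (h.mem_or_exists v).imp_right ?_
  rintro ⟨j', k', rfl⟩
  obtain rfl := h.2.2.2.2 _ _ _ _ hv
  rcases fin_two_eq_or_eq_add_one k k' with rfl | rfl
  · exact absurd hv (G.loopless.irrefl _)
  · rfl

theorem exists_adj_mem (h : IsDimDecomp G W x) {j : Fin m} {k : Fin 2}
    (hd : 2 ≤ deg G (x j k)) : ∃ w ∈ W, G.Adj (x j k) w := by
  by_contra! hW
  have hsub : G.neighborSet (x j k) ⊆ {x j (k + 1)} := fun v hv =>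
    (h.mem_or_eq_of_adj hv).resolve_left fun hvW => hW v hvW hv
  have := Set.ncard_le_ncard hsub
  rw [Set.ncard_singleton] at this
  exact absurd (hd.trans this) (by norm_num)

theorem two_le_deg [Finite V] (h : IsDimDecomp G W x) {j : Fin m} {k : Fin 2} {w : V}
    (hw : w ∈ W) (hadj : G.Adj (x j k) w) : 2 ≤ deg G (x j k) := by
  have hne : w ≠ x j (k + 1) := fun e => h.notMem j (k + 1) (e ▸ hw)
  rw [← Set.ncard_pair hne]
  refine Set.ncard_le_ncard ?_
  rintro v (rfl | rfl)
  · exact hadj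
  · exact h.adj_add_one j k

/-- To verify a vertex cover it suffices to look at the edges at matched vertices. -/
theorem isVertexCover (h : IsDimDecomp G W x) {C : Set V}
    (hC : ∀ j k v, G.Adj (x j k) v → x j k ∈ C ∨ v ∈ C) : IsVertexCover G C := by
  intro u v huv
  rcases h.mem_or_exists u with hu | ⟨j, k, rfl⟩
  · rcases h.mem_or_exists v with hv | ⟨j, k, rfl⟩
    · exact absurd huv (h.2.2.1 u hu v hv)
    · exact (hC j k u huv.symm).symm
  · exact hC j k v huv

theorem ncard_range (h : IsDimDecomp G W x) (κ : Fin m → Fin 2) :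
    (Set.range fun j => x j (κ j)).ncard = m := by
  rw [← Set.image_univ, Set.ncard_image_of_injective _ fun _ _ e => (h.eq_of_apply_eq e).1,
    Set.ncard_univ, Nat.card_fin]

theorem isMinimalVertexCover_side (h : IsDimDecomp G W x) (k : Fin 2) :
    IsMinimalVertexCover G
      ((Set.range fun j => x j k) ∪ {w ∈ W | ∃ j, G.Adj w (x j (k + 1))}) := by
  have hout : ∀ j, x j (k + 1) ∉
      (Set.range fun j => x j k) ∪ {w ∈ W | ∃ j, G.Adj w (x j (k + 1))} := by
    rintro j (⟨j', e⟩ | ⟨hW, -⟩)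
    · exact fin_two_add_one_ne k (h.eq_of_apply_eq e).2.symm
    · exact h.notMem _ _ hW
  refine isMinimalVertexCover_of_exists_adj_notMem (h.isVertexCover fun j k' v hv => ?_) ?_
  · rcases fin_two_eq_or_eq_add_one k k' with rfl | rfl
    · exact .inl (.inl ⟨j, rfl⟩)
    · rcases h.mem_or_eq_of_adj hv with hW | rfl
      · exact .inr (.inr ⟨hW, j, hv.symm⟩)
      · exact .inr (.inl ⟨j, by rw [fin_two_add_one_add_one]⟩)
  · rintro v (⟨j, rfl⟩ | ⟨-, j, hj⟩)
    · exact ⟨_, h.adj_add_one j k, hout j⟩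
    · exact ⟨_, hj, hout j⟩

theorem ncard_side [Finite V] (h : IsDimDecomp G W x) (k : Fin 2) :
    ((Set.range fun j => x j k) ∪ {w ∈ W | ∃ j, G.Adj w (x j (k + 1))}).ncard =
      m + {w ∈ W | ∃ j, G.Adj w (x j (k + 1))}.ncard := by
  rw [Set.ncard_union_eq, h.ncard_range fun _ => k]
  rw [Set.disjoint_left]
  rintro _ ⟨j, rfl⟩ ⟨hW, -⟩
  exact h.notMem _ _ hW

theorem exists_isMinimalVertexCover_ncard_eq [Finite V] (h : IsDimDecomp G W x) :
    ∃ C, IsMinimalVertexCover G C ∧ C.ncard = m + (m2Set G x).ncard := by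
  have hκ : ∀ j, ∃ k, j ∉ m2Set G x → ¬ 2 ≤ deg G (x j (k + 1)) := by
    intro j
    by_contra! hj
    exact (hj 0).1 ⟨(hj 1).2, (hj 0).2⟩
  choose κ hκ using hκ
  have hdeg : ∀ j ∈ m2Set G x, ∀ k, 2 ≤ deg G (x j k) := fun j hj k => by
    rcases fin_two_eq_or_eq_add_one 0 k with rfl | rfl
    exacts [hj.1, hj.2]
  have hsub : ∀ v ∈ (Set.range fun j => x j (κ j)) ∪ (fun j => x j (κ j + 1)) '' m2Set G x,
      v ∉ W := by
    rintro _ (⟨j, rfl⟩ | ⟨j, -, rfl⟩) <;> exact h.notMem _ _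
  refine ⟨(Set.range fun j => x j (κ j)) ∪ (fun j => x j (κ j + 1)) '' m2Set G x,
    isMinimalVertexCover_of_exists_adj_notMem (h.isVertexCover fun j k v hv => ?_) ?_, ?_⟩
  · rcases fin_two_eq_or_eq_add_one (κ j) k with rfl | rfl
    · exact .inl (.inl ⟨j, rfl⟩)
    · by_cases hj : j ∈ m2Set G x
      · exact .inl (.inr ⟨j, hj, rfl⟩)
      · rcases h.mem_or_eq_of_adj hv with hW | rfl
        · exact absurd (h.two_le_deg hW hv) (hκ j hj)
        · exact .inr (.inl ⟨j, by rw [fin_two_add_one_add_one]⟩)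
  · have hnbr : ∀ j ∈ m2Set G x, ∀ k, ∃ u, G.Adj (x j k) u ∧
        u ∉ (Set.range fun j => x j (κ j)) ∪ (fun j => x j (κ j + 1)) '' m2Set G x := by
      intro j hj k
      obtain ⟨w, hw, hadj⟩ := h.exists_adj_mem (hdeg j hj k)
      exact ⟨w, hadj, fun hC => hsub w hC hw⟩
    rintro _ (⟨j, rfl⟩ | ⟨j, hj, rfl⟩)
    · by_cases hj : j ∈ m2Set G x
      · exact hnbr j hj _
      · refine ⟨_, h.adj_add_one j _, ?_⟩
        rintro (⟨j', e⟩ | ⟨j', hj', e⟩)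
        · obtain ⟨rfl, e⟩ := h.eq_of_apply_eq e
          exact fin_two_add_one_ne _ e.symm
        · obtain ⟨rfl, -⟩ := h.eq_of_apply_eq e
          exact hj hj'
    · exact hnbr j hj _
  · rw [Set.ncard_union_eq, h.ncard_range,
      Set.ncard_image_of_injective _ fun _ _ e => (h.eq_of_apply_eq e).1]
    rw [Set.disjoint_left]
    rintro _ ⟨j, rfl⟩ ⟨j', -, e⟩
    obtain ⟨rfl, e⟩ := h.eq_of_apply_eq e
    exact fin_two_add_one_ne _ e

theorem W0_subset (h : IsDimDecomp G W x) :
    W0 G W ⊆ {w ∈ W | ∃ j, G.Adj w (x j (0 + 1))} ∪ {w ∈ W | ∃ j, G.Adj w (x j (1 + 1))} := by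
  rintro w ⟨hw, u, hu⟩
  rcases h.mem_or_exists u with huW | ⟨j, k, rfl⟩
  · exact absurd hu (h.2.2.1 w hw u huW)
  · rcases fin_two_eq_or_eq_add_one 0 k with rfl | rfl
    · exact .inr ⟨hw, j, hu⟩
    · exact .inl ⟨hw, j, hu⟩

end IsDimDecomp

/-- if `G` has a dominating induced matching with decomposition
`V = W ⊔ M` (`W` independent, `G_M` consisting of the `m` disjoint edges
`{x j 0, x j 1}`) and `G` is unmixed, then `#W₀ ≤ 2·m₂`, where `W₀` is the set of
non-isolated vertices of `W` and `m₂` the number of matching edges both of whose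
endpoints have degree at least `2` in `G`. -/
theorem ncard_W0_le_two_mul_m2 {V : Type*} [Fintype V] [DecidableEq V]
    (G : SimpleGraph V) (W : Set V) {m : ℕ} (x : Fin m → Fin 2 → V)
    (hdec : IsDimDecomp G W x) (hG : Unmixed G) :
    (W0 G W).ncard ≤ 2 * (m2Set G x).ncard := by
  obtain ⟨C, hC, hcard⟩ := hdec.exists_isMinimalVertexCover_ncard_eq
  have hside : ∀ k : Fin 2, {w ∈ W | ∃ j, G.Adj w (x j (k + 1))}.ncard = (m2Set G x).ncard := by
    intro k
    have := hG _ _ (hdec.isMinimalVertexCover_side k) hC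
    rw [hdec.ncard_side, hcard] at this
    exact Nat.add_left_cancel this
  calc (W0 G W).ncard ≤ _ := Set.ncard_le_ncard hdec.W0_subset
    _ ≤ _ := Set.ncard_union_le _ _
    _ = 2 * (m2Set G x).ncard := by rw [hside 0, hside 1, two_mul]

end DIM
end

section
/- Let G be a finite simple graph, C a minimal vertex cover of G, and x a vertex of G not belonging to C (so that N_G(x) ⊆ C). Then C \ N_G(x) is a minimal vertex cover of the induced subgraph G \ N_G[x]. -/
namespace DIM

open SimpleGraph

variable {V : Type*}

/-- if `C` is a minimal vertex cover of `G` and `x ∉ C`, then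
`N_G(x) ⊆ C` and `C \ N_G(x)` is a minimal vertex cover of the induced subgraph
`G \ N_G[x]`. -/
theorem diff_neighborSet_isMinimalVertexCoverOn {V : Type*} [Fintype V] [DecidableEq V]
    (G : SimpleGraph V) (C : Set V) (x : V)
    (hC : IsMinimalVertexCover G C) (hx : x ∉ C) :
    G.neighborSet x ⊆ C ∧
    IsMinimalVertexCoverOn G (G.neighborSet x ∪ {x})ᶜ (C \ G.neighborSet x) := by
  have hN : G.neighborSet x ⊆ C := fun v hv => (hC.1 hv).resolve_left hx
  refine ⟨hN, ⟨?_, ?_⟩, ?_⟩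
  · rintro v ⟨hvC, hvN⟩ (hv | rfl)
    exacts [hvN hv, hx hvC]
  · intro u w huw hu hw
    exact (hC.1 huw).imp (fun h => ⟨h, fun hn => hu (Or.inl hn)⟩)
      (fun h => ⟨h, fun hn => hw (Or.inl hn)⟩)
  · intro C' hC' hcov
    have hcover : IsVertexCover G (C' ∪ G.neighborSet x) := by
      intro u w huw
      by_cases hu : u ∈ G.neighborSet x ∪ {x}
      · rcases hu with hu | rfl
        exacts [Or.inl (Or.inr hu), Or.inr (Or.inr huw)]
      by_cases hw : w ∈ G.neighborSet x ∪ {x}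
      · rcases hw with hw | rfl
        exacts [Or.inr (Or.inr hw), Or.inl (Or.inr huw.symm)]
      exact (hcov.2 huw hu hw).imp Or.inl Or.inl
    have heq := hC.2 _ (Set.union_subset (hC'.trans Set.sdiff_subset) hN) hcover
    refine hC'.antisymm fun v hv => ?_
    exact (heq.symm.subset hv.1).resolve_right hv.2

end DIM
end
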